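/- arXiv:1911.12335 — 3 statements merged into one kernel-verified Lean document; each statement's English description precedes it below -/
import Mathlib

section
/- Let F be a field of characteristic 0, T a finite commutative semigroup, and L a finite-dimensional Lie algebra over F equipped with a T-grading, i.e. a family of F-subspaces L^(t) (t ∈ T) such that L is the internal direct sum of the L^(t) and [L^(s), L^(t)] ⊆ L^(st) for all s, t ∈ T. Then there exist a finite-dimensional (not necessarily unital) associative F-algebra A, a family of F-subspaces A^(t) (t ∈ T) such that A is the internal direct sum of the A^(t) and A^(s)·A^(t) ⊆ A^(st) for all s, t ∈ T, and an injective F-linear map ρ : L → A satisfying ρ([x,y]) = ρ(x)ρ(y) − ρ(y)ρ(x) for all x, y ∈ L and ρ(L^(t)) ⊆ A^(t) for all t ∈ T. -/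
/-- A witness for the graded Ado theorem: a finite dimensional (not necessarily unital)
associative `F`-algebra `A`, graded by `T` (internal direct sum of subspaces `Ag t` with
`Ag s * Ag t ⊆ Ag (s * t)`), together with an injective `F`-linear Lie homomorphism
`ρ : L → A⁽⁻⁾` respecting the gradings. -/
structure GradedAdoWitness (F : Type) [Field F] (T : Type) [CommSemigroup T] [DecidableEq T]
    (L : Type) [LieRing L] [LieAlgebra F L] (Lg : T → Submodule F L) where
  /-- The associative algebra. -/
  A : Type
  /-- `A` is a (not necessarily unital) associative ring. -/
  [ringA : NonUnitalRing A]
  /-- `A` is an `F`-vector space. -/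
  [modA : Module F A]
  [sccA : SMulCommClass F A A]
  [istA : IsScalarTower F A A]
  /-- `A` is finite dimensional over `F`. -/
  findim : Module.Finite F A
  /-- The grading subspaces of `A`. -/
  Ag : T → Submodule F A
  /-- `A` is the internal direct sum of the subspaces `Ag t`. -/
  internal : DirectSum.IsInternal Ag
  /-- `Ag s · Ag t ⊆ Ag (s * t)`. -/
  gradedMul : ∀ s t : T, ∀ a ∈ Ag s, ∀ b ∈ Ag t, a * b ∈ Ag (s * t)
  /-- The embedding `ρ`. -/
  ρ : L →ₗ[F] A
  /-- `ρ` is injective. -/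
  inj : Function.Injective ρ
  /-- `ρ [x, y] = ρ x · ρ y − ρ y · ρ x`. -/
  bracket : ∀ x y : L, ρ ⁅x, y⁆ = ρ x * ρ y - ρ y * ρ x
  /-- `ρ (L⁽ᵗ⁾) ⊆ A⁽ᵗ⁾`. -/
  mapsInto : ∀ t : T, (Lg t).map ρ ≤ Ag t

section FiniteCodimension

variable {F A : Type*} [Field F] [Ring A] [Algebra F A]

/-- In a finitely generated algebra, a left ideal of finite codimension is finitely generated. -/
theorem exists_fg_top_mul_eq_of_fg_sup_eq_top {G E J : Submodule F A} (hG : G.FG)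
    (hGA : Algebra.adjoin F (G : Set A) = ⊤) (hJ : ⊤ * J ≤ J) (hE : E.FG) (hEJ : E ⊔ J = ⊤) :
    ∃ S : Submodule F A, S.FG ∧ ⊤ * S = J := by
  obtain ⟨E', hE', hEE', h1⟩ : ∃ E' : Submodule F A, E'.FG ∧ E ≤ E' ∧ (1 : A) ∈ E' :=
    ⟨E ⊔ Submodule.span F {1}, hE.sup (Submodule.fg_span_singleton 1), le_sup_left,
      Submodule.mem_sup_right (Submodule.mem_span_singleton_self 1)⟩
  have hE'J : E' ⊔ J = ⊤ := top_le_iff.mp (hEJ ▸ sup_le_sup_right hEE' J)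
  have hfg : (G * E' ⊔ E').FG := (hG.mul hE').sup hE'
  set S := (G * E' ⊔ E') ⊓ J with hS
  have hSfg : S.FG := by
    have : FiniteDimensional F ↥(G * E' ⊔ E') := Module.Finite.iff_fg.mpr hfg
    exact Module.Finite.iff_fg.mp (Submodule.finiteDimensional_of_le (inf_le_left : S ≤ _))
  have hSJ : ⊤ * S ≤ J := (mul_le_mul' le_rfl inf_le_right).trans hJ
  have hS_le : S ≤ ⊤ * S := fun x hx => by
    simpa using Submodule.mul_mem_mul (Submodule.mem_top (x := (1 : A))) hx
  set X := E' ⊔ ⊤ * S with hX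
  have hGX : G * X ≤ X := by
    rw [hX, Submodule.mul_sup]
    refine sup_le ?_ ?_
    · intro z hz
      obtain ⟨e, he, j, hj, rfl⟩ := Submodule.mem_sup.mp (hE'J ▸ Submodule.mem_top : z ∈ E' ⊔ J)
      refine Submodule.add_mem_sup he (hS_le ⟨?_, hj⟩)
      have := Submodule.sub_mem _ (Submodule.mem_sup_left hz : _ ∈ G * E' ⊔ E')
        (Submodule.mem_sup_right he)
      simpa using this
    · rw [← mul_assoc]
      exact (mul_le_mul' le_top le_rfl).trans le_sup_right
  have hXtop : ∀ a : A, ∀ x ∈ X, a * x ∈ X := by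
    intro a
    have ha : a ∈ Algebra.adjoin F (G : Set A) := hGA ▸ Algebra.mem_top
    induction ha using Algebra.adjoin_induction with
    | mem g hg => exact fun x hx => hGX (Submodule.mul_mem_mul hg hx)
    | algebraMap r =>
      intro x hx
      rw [← Algebra.smul_def]
      exact X.smul_mem r hx
    | add a b _ _ ha hb => exact fun x hx => by rw [add_mul]; exact X.add_mem (ha x hx) (hb x hx)
    | mul a b _ _ ha hb => exact fun x hx => by rw [mul_assoc]; exact ha _ (hb x hx)
  refine ⟨S, hSfg, le_antisymm hSJ fun j hj => ?_⟩
  have hjX : j ∈ X := by simpa using hXtop j 1 (Submodule.mem_sup_left h1)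
  obtain ⟨e, he, t, ht, rfl⟩ := Submodule.mem_sup.mp hjX
  refine (⊤ * S).add_mem (hS_le ⟨Submodule.mem_sup_right he, ?_⟩) ht
  simpa using J.sub_mem hj (hSJ ht)

/-- Powers of a two-sided ideal of finite codimension in a finitely generated algebra have
finite codimension. -/
theorem exists_fg_sup_pow_eq_top {G E I : Submodule F A} (hG : G.FG)
    (hGA : Algebra.adjoin F (G : Set A) = ⊤) (hI : ⊤ * I ≤ I) (hE : E.FG)
    (hEI : E ⊔ I = ⊤) (k : ℕ) : ∃ E' : Submodule F A, E'.FG ∧ E' ⊔ I ^ (k + 1) = ⊤ := by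
  induction k with
  | zero => exact ⟨E, hE, by simpa using hEI⟩
  | succ k ih =>
    obtain ⟨E', hE', hE'I⟩ := ih
    have hle : ⊤ * I ^ (k + 1) ≤ I ^ (k + 1) := by
      rw [pow_succ', ← mul_assoc]
      exact mul_le_mul' hI le_rfl
    obtain ⟨S, hS, hSI⟩ := exists_fg_top_mul_eq_of_fg_sup_eq_top hG hGA hle hE' hE'I
    refine ⟨E * S ⊔ E', (hE.mul hS).sup hE', top_le_iff.mp ?_⟩
    rw [← hE'I, pow_succ' I (k + 1), ← hSI, ← mul_assoc]
    refine sup_le (le_sup_right.trans le_sup_left) ?_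
    nth_rewrite 1 [← hEI]
    rw [Submodule.sup_mul]
    refine sup_le (le_sup_left.trans le_sup_left) ((mul_le_mul' ?_ le_rfl).trans le_sup_right)
    intro x hx
    simpa using Submodule.mul_mem_mul hx (Submodule.mem_top (x := (1 : A)))

end FiniteCodimension

namespace UniversalEnvelopingAlgebra

attribute [local instance] LieRing.ofAssociativeRing

variable {F h : Type*} [Field F] [LieRing h] [LieAlgebra F h]

local notation "𝒰" => UniversalEnvelopingAlgebra F h

/-- A property of elements of an enveloping algebra holds everywhere if it holds for scalars and
generators and is stable under sums and products. -/
theorem induction_on {P : 𝒰 → Prop} (u : 𝒰) (halg : ∀ r, P (algebraMap F 𝒰 r))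
    (hι : ∀ x, P (ι F x)) (hadd : ∀ a b, P a → P b → P (a + b))
    (hmul : ∀ a b, P a → P b → P (a * b)) : P u := by
  let S : Subalgebra F 𝒰 :=
    { carrier := {u | P u}
      mul_mem' := fun {a b} => hmul a b
      add_mem' := fun {a b} => hadd a b
      algebraMap_mem' := halg }
  let f : h →ₗ⁅F⁆ S :=
    { toFun := fun x => ⟨ι F x, hι x⟩
      map_add' := fun x y => Subtype.ext (by simp)
      map_smul' := fun c x => Subtype.ext (by simp)
      map_lie' := fun {x y} => Subtype.ext (by simp [LieRing.of_associative_ring_bracket]) }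
  have hid : S.val.comp (lift F f) = AlgHom.id F 𝒰 := by
    refine hom_ext F (LieHom.ext fun x => ?_)
    simp [f]
  have hu := (lift F f u).2
  rwa [show ((lift F f u : S) : 𝒰) = u from DFunLike.congr_fun hid u] at hu

theorem adjoin_range_ι :
    Algebra.adjoin F ((LinearMap.range (ι F : h →ₗ⁅F⁆ 𝒰).toLinearMap : Submodule F 𝒰) : Set 𝒰)
      = ⊤ := by
  refine top_le_iff.mp fun u _ => ?_
  induction u using induction_on with
  | halg r => exact algebraMap_mem _ r
  | hι x => exact Algebra.subset_adjoin ⟨x, rfl⟩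
  | hadd a b ha hb => exact add_mem (ha trivial) (hb trivial)
  | hmul a b ha hb => exact mul_mem (ha trivial) (hb trivial)

/-- The homomorphism to the trivial square zero extension whose second component is the extension
of a derivation to the enveloping algebra. -/
noncomputable def derivationLift (D : LieDerivation F h h) : 𝒰 →ₐ[F] TrivSqZeroExt 𝒰 𝒰 :=
  lift F
    { toFun := fun x => TrivSqZeroExt.inl (ι F x) + TrivSqZeroExt.inr (ι F (D x))
      map_add' := fun x y => by ext <;> simp
      map_smul' := fun c x => by ext <;> simp
      map_lie' := fun {x y} => by
        ext
        · simp [LieRing.of_associative_ring_bracket, -ι_apply]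
        · simp only [LieDerivation.apply_lie_eq_sub, map_sub, LieHom.map_lie,
            LieRing.of_associative_ring_bracket, TrivSqZeroExt.snd_add, TrivSqZeroExt.snd_sub,
            TrivSqZeroExt.snd_mul, TrivSqZeroExt.snd_inl, TrivSqZeroExt.snd_inr,
            TrivSqZeroExt.fst_add, TrivSqZeroExt.fst_inl, TrivSqZeroExt.fst_inr,
            zero_add, add_zero, smul_eq_mul, MulOpposite.smul_eq_mul_unop, MulOpposite.unop_op]
          abel }

/-- The extension of a derivation of a Lie algebra to its enveloping algebra. -/
noncomputable def derivation (D : LieDerivation F h h) : 𝒰 →ₗ[F] 𝒰 :=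
  TrivSqZeroExt.sndHom 𝒰 𝒰 |>.restrictScalars F |>.comp (derivationLift D).toLinearMap

theorem fst_derivationLift (D : LieDerivation F h h) (u : 𝒰) :
    (derivationLift D u).fst = u := by
  have : (TrivSqZeroExt.fstHom F 𝒰 𝒰).comp (derivationLift D) = AlgHom.id F 𝒰 := by
    refine hom_ext F (LieHom.ext fun x => ?_)
    simp [derivationLift]
  exact DFunLike.congr_fun this u

theorem derivation_ι (D : LieDerivation F h h) (x : h) :
    derivation D (ι F x) = ι F (D x) := by
  simp [derivation, derivationLift]

@[simp]
theorem derivation_algebraMap (D : LieDerivation F h h) (r : F) :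
    derivation D (algebraMap F 𝒰 r) = 0 := by
  simp only [derivation, LinearMap.comp_apply, AlgHom.toLinearMap_apply, AlgHom.commutes,
    TrivSqZeroExt.algebraMap_eq_inl']
  simp

@[simp]
theorem derivation_mul (D : LieDerivation F h h) (u v : 𝒰) :
    derivation D (u * v) = u * derivation D v + derivation D u * v := by
  simp [derivation, fst_derivationLift]

theorem derivation_add (D E : LieDerivation F h h) (u : 𝒰) :
    derivation (D + E) u = derivation D u + derivation E u := by
  induction u using induction_on with
  | halg r => simp
  | hι x => simp only [derivation_ι, LieDerivation.add_apply, map_add]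
  | hadd a b ha hb => simp only [map_add, ha, hb]; abel
  | hmul a b ha hb => simp only [derivation_mul, ha, hb, mul_add, add_mul]; abel

theorem derivation_smul (c : F) (D : LieDerivation F h h) (u : 𝒰) :
    derivation (c • D) u = c • derivation D u := by
  induction u using induction_on with
  | halg r => simp
  | hι x => simp only [derivation_ι, LieDerivation.smul_apply, map_smul]
  | hadd a b ha hb => simp only [map_add, ha, hb, smul_add]
  | hmul a b ha hb =>
    simp only [derivation_mul, ha, hb, smul_add, mul_smul_comm, smul_mul_assoc]

theorem derivation_lie (D E : LieDerivation F h h) (u : 𝒰) :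
    derivation ⁅D, E⁆ u = derivation D (derivation E u) - derivation E (derivation D u) := by
  induction u using induction_on with
  | halg r => simp
  | hι x => simp only [derivation_ι, LieDerivation.lie_apply, map_sub]
  | hadd a b ha hb => simp only [map_add, ha, hb]; abel
  | hmul a b ha hb =>
    simp only [derivation_mul, map_add, ha, hb, mul_sub, sub_mul]
    abel

theorem derivation_mem {D : LieDerivation F h h} {I : Submodule F 𝒰} (hI : ⊤ * I ≤ I)
    (hI' : I * ⊤ ≤ I) (hD : ∀ x, ι F (D x) ∈ I) (u : 𝒰) : derivation D u ∈ I := by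
  induction u using induction_on with
  | halg r => simp
  | hι x => simpa only [derivation_ι] using hD x
  | hadd a b ha hb => simpa only [map_add] using I.add_mem ha hb
  | hmul a b ha hb =>
    rw [derivation_mul]
    exact I.add_mem (hI (Submodule.mul_mem_mul Submodule.mem_top hb))
      (hI' (Submodule.mul_mem_mul ha Submodule.mem_top))

theorem derivation_mem_pow {D : LieDerivation F h h} {I : Submodule F 𝒰}
    (hD : ∀ u, derivation D u ∈ I) (k : ℕ) {u : 𝒰} (hu : u ∈ I ^ k) : derivation D u ∈ I ^ k := by
  induction k generalizing u with
  | zero =>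
    obtain ⟨r, rfl⟩ := Submodule.mem_one.mp (by simpa using hu)
    simp
  | succ k ih =>
    rw [pow_succ'] at hu ⊢
    induction hu using Submodule.mul_induction_on' with
    | mem_mul_mem a ha b hb =>
      rw [derivation_mul]
      exact add_mem (Submodule.mul_mem_mul ha (ih hb)) (Submodule.mul_mem_mul (hD a) hb)
    | add a _ b _ ha hb => simpa using add_mem ha hb

theorem exists_derivation_pow_eq_zero {D : LieDerivation F h h}
    (hD : ∀ x, ∃ k : ℕ, ((D : h →ₗ[F] h) ^ k) x = 0) (u : 𝒰) :
    ∃ k : ℕ, ((derivation D) ^ k) u = 0 := by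
  induction u using induction_on with
  | halg r => exact ⟨1, by simp⟩
  | hι x =>
    obtain ⟨k, hk⟩ := hD x
    have key (k : ℕ) (x : h) :
        ((derivation D) ^ k) (ι F x) = ι F (((D : h →ₗ[F] h) ^ k) x) := by
      induction k generalizing x with
      | zero => rfl
      | succ k ih => rw [pow_succ, pow_succ, Module.End.mul_apply, derivation_ι, ih]; rfl
    exact ⟨k, by rw [key, hk, map_zero]⟩
  | hadd a b ha hb =>
    obtain ⟨k, hk⟩ := ha
    obtain ⟨l, hl⟩ := hb
    refine ⟨k + l, ?_⟩
    rw [map_add, pow_add, Module.End.mul_apply, Module.End.mul_apply, hl, map_zero, add_zero,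
      ← Module.End.mul_apply, ← pow_add, add_comm, pow_add, Module.End.mul_apply, hk, map_zero]
  | hmul a b ha hb =>
    obtain ⟨k, hk⟩ := ha
    obtain ⟨l, hl⟩ := hb
    refine ⟨k + l, ?_⟩
    have key (N : ℕ) : ∀ k l a b, k + l = N → ((derivation D) ^ k) a = 0 →
        ((derivation D) ^ l) b = 0 → ((derivation D) ^ N) (a * b) = 0 := by
      induction N with
      | zero =>
        intro k l a b hN hk _
        obtain rfl : k = 0 := by omega
        have : a = 0 := by simpa using hk
        simp [this]
      | succ N ih =>
        intro k l a b hN hk hl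
        rw [pow_succ, Module.End.mul_apply, derivation_mul, map_add]
        rcases k with _ | k
        · have : a = 0 := by simpa using hk
          simp [this]
        rcases l with _ | l
        · have : b = 0 := by simpa using hl
          simp [this]
        rw [pow_succ, Module.End.mul_apply] at hk hl
        rw [ih (k + 1) l a _ (by omega) (by rwa [pow_succ, Module.End.mul_apply]) hl,
          ih k (l + 1) _ b (by omega) hk (by rwa [pow_succ, Module.End.mul_apply]), add_zero]
    exact key _ k l a b rfl hk hl

end UniversalEnvelopingAlgebra

section NilpotentIdeal

attribute [local instance] LieRing.ofAssociativeRing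

open UniversalEnvelopingAlgebra

variable {F h V : Type*} [Field F] [LieRing h] [LieAlgebra F h] [AddCommGroup V] [Module F V]
  [FiniteDimensional F V] [LieRingModule h V] [LieModule F h V]

theorem LieIdeal.exists_lcs_eq_bot_of_isNilpotent_toEnd (n : LieIdeal F h)
    (hn : ∀ y ∈ n, IsNilpotent (LieModule.toEnd F h V y)) : ∃ k, n.lcs V k = ⊥ := by
  have : LieModule.IsNilpotent n V :=
    (LieModule.isNilpotent_iff_forall' (R := F)).mpr fun x => hn x x.2
  obtain ⟨k, hk⟩ := (LieModule.isNilpotent_iff F n V).mp this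
  refine ⟨k, ?_⟩
  rw [← LieSubmodule.toSubmodule_eq_bot, n.coe_lcs_eq, hk, LieSubmodule.bot_toSubmodule]

/-- If an ideal acts nilpotently on a finite dimensional module, then it generates an ideal of the
enveloping algebra contained in an ideal of finite codimension with a power acting trivially. -/
theorem LieIdeal.exists_ideal_universalEnvelopingAlgebra (n : LieIdeal F h)
    (hn : ∀ y ∈ n, IsNilpotent (LieModule.toEnd F h V y)) :
    ∃ I : Submodule F (UniversalEnvelopingAlgebra F h), ⊤ * I ≤ I ∧ I * ⊤ ≤ I ∧
      (∀ y ∈ n, ι F y ∈ I) ∧ (∃ E : Submodule F (UniversalEnvelopingAlgebra F h), E.FG ∧ E ⊔ I = ⊤) ∧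
      ∃ m : ℕ, ∀ u ∈ I ^ (m + 1), lift F (LieModule.toEnd F h V) u = 0 := by
  obtain ⟨m, hm⟩ := n.exists_lcs_eq_bot_of_isNilpotent_toEnd (V := V) hn
  set ψ := lift F (LieModule.toEnd F h V) with hψ
  have hψι (y : h) : ψ (ι F y) = LieModule.toEnd F h V y := lift_ι_apply F _ y
  have hstab (i : ℕ) (u : UniversalEnvelopingAlgebra F h) :
      ∀ v ∈ n.lcs V i, ψ u v ∈ n.lcs V i := by
    induction u using UniversalEnvelopingAlgebra.induction_on with
    | halg r => intro v hv; rw [AlgHom.commutes]; exact (n.lcs V i).smul_mem r hv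
    | hι x => intro v hv; rw [hψι]; exact (n.lcs V i).lie_mem hv
    | hadd a b ha hb => intro v hv; rw [map_add]; exact add_mem (ha v hv) (hb v hv)
    | hmul a b ha hb => intro v hv; rw [map_mul]; exact ha _ (hb v hv)
  let I : Submodule F (UniversalEnvelopingAlgebra F h) :=
    { carrier := {u | ∀ i, ∀ v ∈ n.lcs V i, ψ u v ∈ n.lcs V (i + 1)}
      add_mem' := fun {a b} ha hb i v hv => by
        rw [map_add]; exact add_mem (ha i v hv) (hb i v hv)
      zero_mem' := fun i v _ => by rw [map_zero]; exact zero_mem _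
      smul_mem' := fun c a ha i v hv => by
        rw [map_smul]; exact (n.lcs V (i + 1)).smul_mem c (ha i v hv) }
  have hker : LinearMap.ker ψ.toLinearMap ≤ I := fun u hu i v _ => by
    rw [show ψ u = 0 from hu]; exact zero_mem _
  refine ⟨I, ?_, ?_, ?_, ?_, m, ?_⟩
  · refine Submodule.mul_le.mpr fun a _ b hb i v hv => ?_
    rw [map_mul]
    exact hstab _ a _ (hb i v hv)
  · refine Submodule.mul_le.mpr fun a ha b _ i v hv => ?_
    rw [map_mul]
    exact ha i _ (hstab _ b v hv)
  · intro y hy i v hv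
    rw [hψι, LieIdeal.lcs_succ]
    exact LieSubmodule.lie_mem_lie hy hv
  · obtain ⟨E, hE⟩ := Submodule.exists_isCompl (LinearMap.ker ψ.toLinearMap)
    refine ⟨E, ?_, ?_⟩
    · have : FiniteDimensional F E := by
        refine FiniteDimensional.of_injective (ψ.toLinearMap.domRestrict E) ?_
        rw [LinearMap.injective_domRestrict_iff]
        exact hE.disjoint.symm
      exact Module.Finite.iff_fg.mp this
    · exact top_le_iff.mp (hE.symm.sup_eq_top ▸ sup_le_sup_left hker E)
  · have key (k : ℕ) : ∀ u ∈ I ^ k, ∀ i, ∀ v ∈ n.lcs V i, ψ u v ∈ n.lcs V (i + k) := by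
      induction k with
      | zero => exact fun u _ i v hv => hstab i u v hv
      | succ k ih =>
        intro u hu
        rw [pow_succ] at hu
        induction hu using Submodule.mul_induction_on' with
        | mem_mul_mem a ha b hb =>
          intro i v hv
          rw [map_mul, ← add_assoc, add_right_comm]
          exact ih a ha _ _ (hb i v hv)
        | add a _ b _ ha hb =>
          intro i v hv
          rw [map_add]
          exact add_mem (ha i v hv) (hb i v hv)
    intro u hu
    ext v
    have h1 := key (m + 1) u hu 0 v (by simp)
    have h2 : n.lcs V (0 + (m + 1)) ≤ ⊥ := by
      rw [zero_add, LieIdeal.lcs_succ, hm, LieSubmodule.lie_bot]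
    simpa using h2 h1

end NilpotentIdeal

section ZassenhausExtension

attribute [local instance] LieRing.ofAssociativeRing

open UniversalEnvelopingAlgebra

universe u

variable {F g V : Type u} [Field F] [LieRing g] [LieAlgebra F g]

/-- The action of a Lie algebra on an ideal, as a homomorphism to the derivations. -/
def LieIdeal.adDerivation (h : LieIdeal F g) : g →ₗ⁅F⁆ LieDerivation F h h where
  toFun x :=
    { toLinearMap := LieModule.toEnd F g h x
      leibniz' := fun a b => Subtype.ext <| by simp [← lie_skew b.1 ⁅x, a.1⁆] }
  map_add' x y := LieDerivation.ext fun a => Subtype.ext <| by simp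
  map_smul' c x := LieDerivation.ext fun a => Subtype.ext <| by simp
  map_lie' {x y} := LieDerivation.ext fun a => Subtype.ext <| by simp

theorem LieIdeal.adDerivation_apply (h : LieIdeal F g) (x : g) (a : h) :
    h.adDerivation x a = ⁅x, a⁆ := rfl

theorem LieIdeal.derivation_adDerivation_coe (h : LieIdeal F g) (a : h)
    (u : UniversalEnvelopingAlgebra F h) :
    derivation (h.adDerivation a) u = ι F a * u - u * ι F a := by
  induction u using UniversalEnvelopingAlgebra.induction_on with
  | halg r => simp [Algebra.commutes]
  | hι x =>
    rw [derivation_ι, h.adDerivation_apply, ← LieRing.of_associative_ring_bracket,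
      ← LieHom.map_lie]
    rfl
  | hadd a b ha hb => simp only [map_add, ha, hb, mul_add, add_mul]; abel
  | hmul a b ha hb => simp only [derivation_mul, ha, hb, mul_sub, sub_mul, mul_assoc]; abel

/-- The action of a Lie algebra on the enveloping algebra of an ideal determined by a projection
onto the ideal. -/
noncomputable def LieIdeal.envelopingAction (h : LieIdeal F g) (P : g →ₗ[F] h) (x : g) :
    Module.End F (UniversalEnvelopingAlgebra F h) :=
  derivation (h.adDerivation x) + LinearMap.mulRight F (ι F (P x))

theorem LieIdeal.envelopingAction_apply (h : LieIdeal F g) (P : g →ₗ[F] h) (x : g)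
    (u : UniversalEnvelopingAlgebra F h) :
    h.envelopingAction P x u = derivation (h.adDerivation x) u + u * ι F (P x) := rfl

theorem LieIdeal.envelopingAction_coe {h : LieIdeal F g} {P : g →ₗ[F] h}
    (hP : ∀ y : h, P y = y) (y : h) (u : UniversalEnvelopingAlgebra F h) :
    h.envelopingAction P y u = ι F y * u := by
  rw [envelopingAction_apply, derivation_adDerivation_coe, hP, sub_add_cancel]

theorem LieIdeal.envelopingAction_lie {h : LieIdeal F g} {P : g →ₗ[F] h}
    (hP : ∀ x y : g, P ⁅x, y⁆ = ⁅x, P y⁆ - ⁅y, P x⁆ - ⁅P x, P y⁆) (x y : g)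
    (u : UniversalEnvelopingAlgebra F h) :
    h.envelopingAction P ⁅x, y⁆ u = h.envelopingAction P x (h.envelopingAction P y u) -
      h.envelopingAction P y (h.envelopingAction P x u) := by
  simp only [envelopingAction_apply, LieHom.map_lie, derivation_lie, map_add, derivation_mul,
    derivation_ι, hP, map_sub, adDerivation_apply, LieRing.of_associative_ring_bracket, mul_sub,
    mul_assoc]
  abel

/-- **Zassenhaus extension**: a representation of an ideal with a complementary subalgebra extends
to the whole algebra, keeping faithfulness and nilpotency. -/
theorem LieIdeal.exists_extension [FiniteDimensional F g] (h n : LieIdeal F g)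
    (hn : ∀ x : g, ∀ y ∈ h, ⁅x, y⁆ ∈ n) (P : g →ₗ[F] h) (hPh : ∀ y : h, P y = y)
    (hP : ∀ x y : g, P ⁅x, y⁆ = ⁅x, P y⁆ - ⁅y, P x⁆ - ⁅P x, P y⁆)
    [AddCommGroup V] [Module F V] [FiniteDimensional F V] (ρ : h →ₗ⁅F⁆ Module.End F V)
    (hinj : ∀ y, ρ y = 0 → y = 0) (hnil : ∀ y : h, (y : g) ∈ n → IsNilpotent (ρ y)) :
    ∃ (W : Type u) (_ : AddCommGroup W) (_ : Module F W) (_ : FiniteDimensional F W)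
      (σ : g →ₗ⁅F⁆ Module.End F W), (∀ y ∈ h, σ y = 0 → y = 0) ∧
      (∀ y ∈ h, y ∈ n → IsNilpotent (σ y)) ∧
      ∀ x, P x = 0 → IsNilpotent (LieAlgebra.ad F g x) → IsNilpotent (σ x) := by
  let _ : LieRingModule h V := LieRingModule.compLieHom V ρ
  have : LieModule F h V := LieModule.compLieHom V ρ
  have hρ : LieModule.toEnd F h V = ρ := rfl
  obtain ⟨I, hI, hI', hIn, ⟨E, hE, hEI⟩, m, hm⟩ :=
    (n.comap h.incl).exists_ideal_universalEnvelopingAlgebra (V := V) (by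
      intro y hy; rw [hρ]; exact hnil y hy)
  obtain ⟨E', hE', hEI'⟩ := exists_fg_sup_pow_eq_top
    (G := LinearMap.range (ι F : h →ₗ⁅F⁆ UniversalEnvelopingAlgebra F h).toLinearMap)
    (Module.Finite.iff_fg.mp inferInstance) adjoin_range_ι hI hE hEI m
  set J := I ^ (m + 1) with hJ
  have hδ (x : g) (u) : derivation (h.adDerivation x) u ∈ I :=
    derivation_mem hI hI' (fun y => hIn _ (hn x y y.2)) u
  have hJr (u v) (hu : u ∈ J) : u * v ∈ J := by
    rw [hJ, pow_succ] at hu ⊢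
    have : I ^ m * I * ⊤ ≤ I ^ m * I := by
      rw [mul_assoc]; exact mul_le_mul' le_rfl hI'
    exact this (Submodule.mul_mem_mul hu trivial)
  have hT (x : g) : J ≤ J.comap (h.envelopingAction P x) := fun u hu => by
    rw [Submodule.mem_comap, envelopingAction_apply]
    exact J.add_mem (derivation_mem_pow (hδ x) _ hu) (hJr _ _ hu)
  have hfin : FiniteDimensional F (UniversalEnvelopingAlgebra F h ⧸ J) := by
    have : FiniteDimensional F E' := Module.Finite.iff_fg.mpr hE'
    refine Module.Finite.of_surjective (J.mkQ.domRestrict E') fun q => ?_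
    obtain ⟨u, rfl⟩ := J.mkQ_surjective q
    obtain ⟨e, he, j, hj, rfl⟩ := Submodule.mem_sup.mp (hEI' ▸ Submodule.mem_top : u ∈ E' ⊔ J)
    exact ⟨⟨e, he⟩, (Submodule.Quotient.eq J).mpr (by simpa using hj)⟩
  let σ : g →ₗ⁅F⁆ Module.End F (UniversalEnvelopingAlgebra F h ⧸ J) :=
    { toFun := fun x => J.mapQ J (h.envelopingAction P x) (hT x)
      map_add' := fun x y => Submodule.linearMap_qext _ <| LinearMap.ext fun u => by
        simp [envelopingAction_apply, derivation_add, mul_add, -ι_apply]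
        abel
      map_smul' := fun c x => Submodule.linearMap_qext _ <| LinearMap.ext fun u => by
        simp [envelopingAction_apply, derivation_smul, -ι_apply]
      map_lie' := fun {x y} => Submodule.linearMap_qext _ <| LinearMap.ext fun u => by
        simp [envelopingAction_lie hP, LieRing.of_associative_ring_bracket] }
  have hσ (x : g) (k : ℕ) (u) : (σ x ^ k) (J.mkQ u) = J.mkQ ((h.envelopingAction P x ^ k) u) := by
    induction k generalizing u with
    | zero => rfl
    | succ k ih => rw [pow_succ, pow_succ, Module.End.mul_apply, Module.End.mul_apply, ← ih]; rfl
  refine ⟨_, inferInstance, inferInstance, hfin, σ, ?_, ?_, ?_⟩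
  · intro y hy hy0
    have h1 : J.mkQ (h.envelopingAction P y 1) = 0 := by
      rw [← pow_one (h.envelopingAction P y), ← hσ, pow_one, hy0, LinearMap.zero_apply]
    rw [← Subtype.coe_mk y hy, envelopingAction_coe hPh, mul_one, Submodule.mkQ_apply,
      Submodule.Quotient.mk_eq_zero] at h1
    have h2 := hm _ h1
    rw [lift_ι_apply] at h2
    exact congrArg Subtype.val (hinj _ h2)
  · intro y hy hyn
    refine ⟨m + 1, Submodule.linearMap_qext _ <| LinearMap.ext fun u => ?_⟩
    have key (k : ℕ) (u) : (h.envelopingAction P y ^ k) u = (ι F (⟨y, hy⟩ : h)) ^ k * u := by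
      induction k generalizing u with
      | zero => simp
      | succ k ih =>
        rw [pow_succ, Module.End.mul_apply, ih, pow_succ, mul_assoc]
        exact congrArg _ (envelopingAction_coe hPh ⟨y, hy⟩ u)
    rw [LinearMap.comp_apply, hσ, key, LinearMap.comp_apply, LinearMap.zero_apply,
      Submodule.mkQ_apply, Submodule.Quotient.mk_eq_zero]
    exact hJr _ _ (Submodule.pow_mem_pow I (hIn _ hyn) _)
  · intro x hx hnil
    obtain ⟨k, hk⟩ := hnil
    rw [Module.End.isNilpotent_iff_of_finite]
    intro q
    obtain ⟨u, rfl⟩ := J.mkQ_surjective q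
    have hloc (y : h) : ((h.adDerivation x : h →ₗ[F] h) ^ k) y = 0 := by
      have aux (k : ℕ) (y : h) : (((h.adDerivation x : h →ₗ[F] h) ^ k) y : g) =
          ((LieAlgebra.ad F g x) ^ k) y := by
        induction k generalizing y with
        | zero => rfl
        | succ k ih => rw [pow_succ, pow_succ, Module.End.mul_apply, Module.End.mul_apply, ih]; rfl
      exact Subtype.ext (by rw [aux, hk]; rfl)
    obtain ⟨l, hl⟩ := exists_derivation_pow_eq_zero (fun y => ⟨k, hloc y⟩) u
    refine ⟨l, ?_⟩
    have hx' : h.envelopingAction P x = derivation (h.adDerivation x) :=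
      LinearMap.ext fun u => by rw [envelopingAction_apply, hx, map_zero, mul_zero, add_zero]
    rw [hσ, hx', hl, map_zero]

end ZassenhausExtension

section NilpotentEnlargement

attribute [local instance] LieRing.ofAssociativeRing

universe u

variable {F : Type u} [Field F]

/-- The direct sum of two representations. -/
def LieHom.prodEnd {g V W : Type*} [LieRing g] [LieAlgebra F g] [AddCommGroup V] [Module F V]
    [AddCommGroup W] [Module F W] (σ : g →ₗ⁅F⁆ Module.End F V) (τ : g →ₗ⁅F⁆ Module.End F W) :
    g →ₗ⁅F⁆ Module.End F (V × W) where
  toFun x := (σ x).prodMap (τ x)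
  map_add' x y := by ext <;> simp
  map_smul' c x := by ext <;> simp
  map_lie' {x y} := by ext <;> simp [LieRing.of_associative_ring_bracket]

theorem LieHom.prodEnd_apply {g V W : Type*} [LieRing g] [LieAlgebra F g] [AddCommGroup V]
    [Module F V] [AddCommGroup W] [Module F W] (σ : g →ₗ⁅F⁆ Module.End F V)
    (τ : g →ₗ⁅F⁆ Module.End F W) (x : g) : σ.prodEnd τ x = (σ x).prodMap (τ x) := rfl

theorem LieHom.prodEnd_eq_zero_iff {g V W : Type*} [LieRing g] [LieAlgebra F g] [AddCommGroup V]
    [Module F V] [AddCommGroup W] [Module F W] {σ : g →ₗ⁅F⁆ Module.End F V}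
    {τ : g →ₗ⁅F⁆ Module.End F W} {x : g} : σ.prodEnd τ x = 0 ↔ σ x = 0 ∧ τ x = 0 := by
  rw [prodEnd_apply]
  refine ⟨fun h => ⟨LinearMap.ext fun v => ?_, LinearMap.ext fun w => ?_⟩, fun h => ?_⟩
  · exact congrArg Prod.fst (DFunLike.congr_fun h (v, 0))
  · exact congrArg Prod.snd (DFunLike.congr_fun h (0, w))
  · rw [h.1, h.2, LinearMap.prodMap_zero]

theorem LinearMap.isNilpotent_prodMap {V W : Type*} [AddCommGroup V] [Module F V] [AddCommGroup W]
    [Module F W] {a : Module.End F V} {b : Module.End F W} (ha : IsNilpotent a)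
    (hb : IsNilpotent b) : IsNilpotent (a.prodMap b : Module.End F (V × W)) := by
  obtain ⟨k, hk⟩ := ha
  obtain ⟨l, hl⟩ := hb
  have : IsNilpotent (a, b) := ⟨k + l, Prod.ext (by simp [pow_add, hk]) (by simp [pow_add, hl])⟩
  exact this.map (LinearMap.prodMapRingHom F V W)

theorem LieIdeal.isNilpotent_ad_of_coe {g : Type*} [LieRing g] [LieAlgebra F g] (h : LieIdeal F g)
    {y : h} (hy : IsNilpotent (LieAlgebra.ad F g y)) : IsNilpotent (LieAlgebra.ad F h y) := by
  obtain ⟨l, hl⟩ := hy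
  have aux (l : ℕ) (z : h) : (((LieAlgebra.ad F h y) ^ l) z : g) =
      ((LieAlgebra.ad F g y) ^ l) z := by
    induction l generalizing z with
    | zero => rfl
    | succ l ih => rw [pow_succ, pow_succ, Module.End.mul_apply, Module.End.mul_apply, ih]; rfl
  refine ⟨l, LinearMap.ext fun z => Subtype.ext ?_⟩
  rw [aux, hl]
  rfl

/-- A finite dimensional Lie algebra with an ideal containing the derived algebra and acting
nilpotently has a faithful representation in which this ideal acts nilpotently. -/
theorem LieAlgebra.exists_faithful_of_isNilpotent_ad (k : ℕ) :
    ∀ (r : Type u) [LieRing r] [LieAlgebra F r] [FiniteDimensional F r],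
      Module.finrank F r = k → ∀ n : LieIdeal F r, (∀ x y : r, ⁅x, y⁆ ∈ n) →
      (∀ y ∈ n, IsNilpotent (LieAlgebra.ad F r y)) →
      ∃ (V : Type u) (_ : AddCommGroup V) (_ : Module F V) (_ : FiniteDimensional F V)
        (ρ : r →ₗ⁅F⁆ Module.End F V), (∀ y, ρ y = 0 → y = 0) ∧
        ∀ y ∈ n, IsNilpotent (ρ y) := by
  induction k with
  | zero =>
    intro r _ _ _ hr n _ _
    have : Subsingleton r := Module.finrank_zero_iff.mp hr
    exact ⟨PUnit, inferInstance, inferInstance, inferInstance, 0, fun y _ => Subsingleton.elim _ _,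
      fun y _ => ⟨1, by simp⟩⟩
  | succ k ih =>
    intro r _ _ _ hr n hn hnil
    have : Nontrivial r := Module.nontrivial_of_finrank_pos (R := F) (by omega)
    obtain ⟨n₀, hn₀, hbr, hle⟩ : ∃ n₀ : LieIdeal F r, n₀ ≠ ⊤ ∧ (∀ x y : r, ⁅x, y⁆ ∈ n₀) ∧
        (n = ⊤ ∨ n ≤ n₀) := by
      by_cases h : n = ⊤
      · have : LieRing.IsNilpotent r :=
          (LieAlgebra.isNilpotent_iff_forall (R := F)).mpr fun x => hnil x (h ▸ trivial)
        refine ⟨derivedSeries F r 1, (derivedSeries_lt_top_of_solvable F r).ne, fun x y => ?_,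
          Or.inl h⟩
        exact LieSubmodule.lie_mem_lie (LieSubmodule.mem_top _) (LieSubmodule.mem_top _)
      · exact ⟨n, h, hn, Or.inr le_rfl⟩
    obtain ⟨f, hf0, hf⟩ := Submodule.exists_le_ker_of_lt_top n₀.toSubmodule
      (lt_top_iff_ne_top.mpr (by simpa using hn₀))
    have hfbr (x y : r) : f ⁅x, y⁆ = 0 := hf (hbr x y)
    let h : LieIdeal F r := { LinearMap.ker f with lie_mem := fun {x y} _ => hfbr x y }
    have hmem (y : r) : y ∈ h ↔ f y = 0 := Iff.rfl
    have hk : Module.finrank F h = k := by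
      have := Module.Dual.finrank_ker_add_one_of_ne_zero hf0
      change Module.finrank F (LinearMap.ker f) = k
      omega
    obtain ⟨x, hx⟩ : ∃ x, f x = 1 := LinearMap.surjective hf0 1
    let P : r →ₗ[F] h :=
      { toFun := fun y => ⟨y - f y • x, by simp [hmem, hx]⟩
        map_add' := fun y z => Subtype.ext (by simp [add_smul]; abel)
        map_smul' := fun c z => Subtype.ext (by simp [mul_smul, smul_sub]) }
    obtain ⟨V, _, _, _, ρ, hρ, hρn⟩ := ih h hk (n.comap h.incl) (fun y z => hn y z)
      (fun y hy => h.isNilpotent_ad_of_coe (hnil y hy))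
    obtain ⟨W, _, _, _, σ, hσ, hσn, hσx⟩ := h.exists_extension (n ⊓ h)
      (fun x y _ => ⟨hn x y, hfbr x y⟩) P
      (fun y => Subtype.ext (by simp [P, (hmem _).mp y.2]))
      (fun y z => Subtype.ext (by
        change ⁅y, z⁆ - f ⁅y, z⁆ • x = ⁅y, z - f z • x⁆ - ⁅z, y - f y • x⁆ -
          ⁅y - f y • x, z - f z • x⁆
        simp only [hfbr, zero_smul, sub_zero, lie_sub, lie_smul, sub_lie, smul_lie, lie_self,
          smul_zero]
        rw [← lie_skew z y, ← lie_skew z x]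
        module))
      ρ hρ (fun y hy => hρn y hy.1)
    let E : Module.End F (F × F) := LinearMap.inr F F F ∘ₗ LinearMap.fst F F F
    have hE : E * E = 0 := by ext <;> simp [E]
    let τ : r →ₗ⁅F⁆ Module.End F (F × F) :=
      { toFun := fun y => f y • E
        map_add' := fun y z => by simp [add_smul]
        map_smul' := fun c y => by simp [mul_smul]
        map_lie' := fun {y z} => by
          simp [hfbr, LieRing.of_associative_ring_bracket, hE] }
    refine ⟨W × F × F, inferInstance, inferInstance, inferInstance, σ.prodEnd τ, ?_, ?_⟩
    · intro y hy
      obtain ⟨h1, h2⟩ := LieHom.prodEnd_eq_zero_iff.mp hy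
      refine hσ y ?_ h1
      have := congrArg Prod.snd (DFunLike.congr_fun h2 (1, 0))
      rw [hmem]
      simpa [τ, E] using this
    · intro y hy
      refine LinearMap.isNilpotent_prodMap ?_ ⟨2, (show (f y • E) ^ 2 = 0 by simp [pow_two, hE])⟩
      rcases hle with hle | hle
      · let : LieRingModule r W := LieRingModule.compLieHom W σ
        have : LieModule F r W := LieModule.compLieHom W σ
        have hh : LieModule.IsNilpotent h W :=
          (LieModule.isNilpotent_iff_forall' (R := F)).mpr fun z =>
            hσn z z.2 ⟨hle ▸ trivial, z.2⟩
        have hxn : IsNilpotent (LieModule.toEnd F r W x) :=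
          hσx x (Subtype.ext (by simp [P, hx])) (hnil x (hle ▸ trivial))
        have := LieSubmodule.isNilpotentOfIsNilpotentSpanSupEqTop (I := h) (top_le_iff.mp ?_) hxn hh
        · exact LieModule.isNilpotent_toEnd_of_isNilpotent F r W y
        · intro z _
          exact Submodule.mem_sup.mpr ⟨f z • x, Submodule.smul_mem _ _
            (Submodule.mem_span_singleton_self x), P z, (P z).2, by simp [P]⟩
      · exact hσn y (hf (hle hy)) ⟨hy, hf (hle hy)⟩

end NilpotentEnlargement

section SolvableIdeal

attribute [local instance] LieRing.ofAssociativeRing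

open scoped TensorProduct

/-- Over an algebraically closed field, the bracket of a Lie algebra with a solvable ideal acts
nilpotently on finite dimensional modules. -/
theorem LieIdeal.isNilpotent_toEnd_of_isSolvable_of_isAlgClosed {K g : Type*} [Field K]
    [CharZero K] [IsAlgClosed K] [LieRing g] [LieAlgebra K g] (R : LieIdeal K g)
    [LieAlgebra.IsSolvable R] (k : ℕ) : ∀ (V : Type*) [AddCommGroup V] [Module K V]
      [FiniteDimensional K V] [LieRingModule g V] [LieModule K g V], Module.finrank K V = k →
      ∀ y ∈ ⁅(⊤ : LieIdeal K g), R⁆, IsNilpotent (LieModule.toEnd K g V y) := by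
  induction k using Nat.strong_induction_on with
  | _ k ih =>
  intro V _ _ _ _ _ hV y hy
  rcases subsingleton_or_nontrivial V with hsub | _
  · exact ⟨1, LinearMap.ext fun v => Subsingleton.elim _ _⟩
  obtain ⟨χ, hχ⟩ := LieModule.exists_nontrivial_weightSpace_of_isSolvable K R V
  let N : LieSubmodule K g V := LieModule.weightSpaceOfIsLieTower K V χ
  have hN : Nontrivial N := hχ
  have hNχ (z : R) (v : N) : ⁅(z : g), v⁆ = χ z • v :=
    Subtype.ext ((LieModule.mem_weightSpace χ v.1).mp v.2 z)
  have hzero (v : V) (hv : v ∈ N) : ⁅y, v⁆ = 0 := by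
    have hle : (⁅(⊤ : LieIdeal K g), R⁆).toSubmodule ≤
        LinearMap.ker ((LieModule.toEnd K g V).toLinearMap.flip v) := by
      rw [LieSubmodule.lieIdeal_oper_eq_linear_span', Submodule.span_le]
      rintro - ⟨x, -, z, hz, rfl⟩
      have hxz : ⁅x, z⁆ ∈ R := R.lie_mem hz
      have htr : LinearMap.trace K N (LieModule.toEnd K g N ⁅x, z⁆) = 0 := by
        rw [LieHom.map_lie, LinearMap.trace_lie]
      have heq : LieModule.toEnd K g N ⁅x, z⁆ = χ ⟨_, hxz⟩ • LinearMap.id :=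
        LinearMap.ext fun v => hNχ ⟨_, hxz⟩ v
      rw [heq, map_smul, LinearMap.trace_id, smul_eq_mul, mul_eq_zero, Nat.cast_eq_zero] at htr
      have hχ0 := htr.resolve_right Module.finrank_pos.ne'
      have := congrArg Subtype.val (hNχ ⟨_, hxz⟩ ⟨v, hv⟩)
      rw [hχ0, zero_smul] at this
      exact this
    exact hle hy
  have hlt : Module.finrank K (V ⧸ N) < k := by
    have h1 := Submodule.finrank_quotient_add_finrank N.toSubmodule
    have h2 : 0 < Module.finrank K N := Module.finrank_pos
    change Module.finrank K (V ⧸ N.toSubmodule) < k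
    change 0 < Module.finrank K N.toSubmodule at h2
    omega
  obtain ⟨l, hl⟩ := ih _ hlt (V ⧸ N) rfl y hy
  have hmk (j : ℕ) (v : V) : (LieModule.toEnd K g (V ⧸ N) y ^ j) (LieSubmodule.Quotient.mk v) =
      LieSubmodule.Quotient.mk ((LieModule.toEnd K g V y ^ j) v) := by
    induction j generalizing v with
    | zero => rfl
    | succ j ih =>
      rw [pow_succ, pow_succ, Module.End.mul_apply, Module.End.mul_apply, ← ih]
      rfl
  refine ⟨l + 1, LinearMap.ext fun v => ?_⟩
  rw [pow_succ', Module.End.mul_apply]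
  refine hzero _ ?_
  refine (LieSubmodule.Quotient.mk_eq_zero N).mp ((hmk l v).symm.trans ?_)
  rw [hl]
  rfl

theorem LieIdeal.isSolvable_iff_exists {F g : Type*} [Field F] [LieRing g] [LieAlgebra F g]
    (R : LieIdeal F g) :
    LieAlgebra.IsSolvable R ↔ ∃ k, LieAlgebra.derivedSeriesOfIdeal F g k R = ⊥ := by
  rw [LieAlgebra.isSolvable_iff F]
  exact exists_congr fun k => R.derivedSeries_eq_bot_iff k

/-- The bracket of a Lie algebra with a solvable ideal acts nilpotently on finite dimensional
modules in characteristic zero. -/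
theorem LieIdeal.isNilpotent_toEnd_of_isSolvable {F g V : Type*} [Field F]
    [CharZero F] [LieRing g] [LieAlgebra F g] (R : LieIdeal F g)
    [LieAlgebra.IsSolvable R] [AddCommGroup V] [Module F V] [FiniteDimensional F V]
    [LieRingModule g V] [LieModule F g V] {y : g} (hy : y ∈ ⁅(⊤ : LieIdeal F g), R⁆) :
    IsNilpotent (LieModule.toEnd F g V y) := by
  let K := AlgebraicClosure F
  have : CharZero K := charZero_of_injective_algebraMap (algebraMap F K).injective
  have : LieAlgebra.IsSolvable (R.baseChange K) := by
    obtain ⟨k, hk⟩ := R.isSolvable_iff_exists.mp inferInstance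
    refine (LieIdeal.isSolvable_iff_exists (R.baseChange K)).mpr ⟨k, ?_⟩
    rw [LieAlgebra.derivedSeriesOfIdeal_baseChange, hk, LieSubmodule.baseChange_bot]
  have hyK : (1 : K) ⊗ₜ[F] y ∈ ⁅(⊤ : LieIdeal K (K ⊗[F] g)), R.baseChange K⁆ := by
    rw [← LieSubmodule.baseChange_top, ← LieSubmodule.lie_baseChange]
    exact LieSubmodule.tmul_mem_baseChange_of_mem 1 hy
  have hnil := isNilpotent_toEnd_of_isSolvable_of_isAlgClosed (R.baseChange K) _ (K ⊗[F] V) rfl _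
    hyK
  rw [LieModule.toEnd_baseChange] at hnil
  exact (IsNilpotent.map_iff (f := Module.End.baseChangeHom F K V)
    (LinearMap.baseChangeHom_injective F V K)).mp hnil

/-- The quotient map of a Lie algebra by an ideal, as a morphism of Lie algebras. -/
def LieIdeal.quotientHom {F g : Type*} [Field F] [LieRing g] [LieAlgebra F g] (I : LieIdeal F g) :
    g →ₗ⁅F⁆ g ⧸ I :=
  { (LieSubmodule.Quotient.mk' I : g →ₗ[F] g ⧸ I) with
    map_lie' := fun {x y} => LieSubmodule.Quotient.mk_bracket I x y }

theorem LieIdeal.quotientHom_eq_zero_iff {F g : Type*} [Field F] [LieRing g] [LieAlgebra F g]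
    (I : LieIdeal F g) {x : g} : I.quotientHom x = 0 ↔ x ∈ I :=
  LieSubmodule.Quotient.mk_eq_zero I

theorem LieIdeal.quotientHom_surjective {F g : Type*} [Field F] [LieRing g] [LieAlgebra F g]
    (I : LieIdeal F g) : Function.Surjective I.quotientHom :=
  fun y => LieSubmodule.Quotient.surjective_mk' I y

/-- The quotient of a Lie algebra by its radical has trivial radical. -/
theorem LieAlgebra.hasTrivialRadical_quotient_radical (F g : Type*) [Field F] [LieRing g]
    [LieAlgebra F g] [FiniteDimensional F g] :
    HasTrivialRadical F (g ⧸ radical F g) := by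
  rw [hasTrivialRadical_iff_no_abelian_ideals]
  intro I hI
  let J : LieIdeal F g := I.comap (radical F g).quotientHom
  have hJ : ⁅J, J⁆ ≤ radical F g := by
    rw [LieSubmodule.lie_le_iff]
    intro x hx y hy
    rw [← LieIdeal.quotientHom_eq_zero_iff, LieHom.map_lie]
    exact congrArg Subtype.val (hI.trivial ⟨_, hx⟩ ⟨_, hy⟩)
  obtain ⟨k, hk⟩ := (radical F g).isSolvable_iff_exists.mp inferInstance
  have hJs : IsSolvable J := by
    refine (LieIdeal.isSolvable_iff_exists J).mpr ⟨k + 1, le_bot_iff.mp ?_⟩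
    rw [derivedSeriesOfIdeal_add, ← hk]
    exact derivedSeriesOfIdeal_mono hJ k
  rw [LieIdeal.solvable_iff_le_radical] at hJs
  refine le_bot_iff.mp fun x hx => ?_
  obtain ⟨x, rfl⟩ := (radical F g).quotientHom_surjective x
  exact (radical F g).quotientHom_eq_zero_iff.mpr (hJs hx)

end SolvableIdeal

section InvariantVectors

open LieModule TensorProduct

universe u

variable {F : Type u} [Field F]

/-- The Casimir element of an ideal on which a trace form is nondegenerate. -/
theorem LieIdeal.exists_casimir {s N : Type*} [LieRing s] [LieAlgebra F s] [FiniteDimensional F s]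
    [AddCommGroup N] [Module F N] [LieRingModule s N] [LieModule F s N] (j : LieIdeal F s)
    (hj : ∀ x ∈ j, (∀ y ∈ j, traceForm F s N x y = 0) → x = 0) :
    ∃ b b' : Fin (Module.finrank F j) → s, (∀ i, traceForm F s N (b i) (b' i) = 1) ∧
      ∀ x : s, ∑ i, (⁅x, b i⁆ ⊗ₜ[F] b' i + b i ⊗ₜ[F] ⁅x, b' i⁆) = 0 := by
  let B : LinearMap.BilinForm F j := (traceForm F s N).restrict j.toSubmodule
  have hBs : B.IsSymm := ⟨fun x y => traceForm_comm F s N x y⟩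
  have hB : B.Nondegenerate := by
    refine hBs.isRefl.nondegenerate_iff_separatingLeft.mpr ?_
    exact fun x hx => Subtype.ext (hj x x.2 fun y hy => hx ⟨y, hy⟩)
  let b := Module.finBasis F j
  let b' := B.dualBasis hB b
  have hb (y : j) : (y : s) = ∑ k, traceForm F s N y (b' k) • (b k : s) := by
    have h := b.sum_repr y
    have h2 (k) : b.repr y k = B y (b' k) := by
      rw [← LinearMap.BilinForm.dualBasis_repr_apply hB, LinearMap.BilinForm.dualBasis_dualBasis hB hBs]
    simp only [h2] at h
    exact_mod_cast congrArg Subtype.val h.symm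
  have hb' (y : j) : (y : s) = ∑ k, traceForm F s N y (b k) • (b' k : s) := by
    have h := b'.sum_repr y
    simp only [b', LinearMap.BilinForm.dualBasis_repr_apply] at h
    exact_mod_cast congrArg Subtype.val h.symm
  refine ⟨fun i => b i, fun i => b' i, fun i => ?_, fun x => ?_⟩
  · have := LinearMap.BilinForm.apply_dualBasis_left hB b i i
    rw [if_pos rfl] at this
    rw [traceForm_comm]
    exact this
  · have h1 (i) : ⁅x, (b i : s)⁆ = ∑ k, traceForm F s N ⁅x, (b i : s)⁆ (b' k) • (b k : s) :=
      hb ⁅x, b i⁆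
    have h2 (i) : ⁅x, (b' i : s)⁆ = ∑ k, traceForm F s N ⁅x, (b' i : s)⁆ (b k) • (b' k : s) :=
      hb' ⁅x, b' i⁆
    rw [Finset.sum_add_distrib]
    conv_lhs =>
      enter [1, 2, i]
      rw [h1, TensorProduct.sum_tmul]
    conv_lhs =>
      enter [2, 2, i]
      rw [h2, TensorProduct.tmul_sum]
    rw [Finset.sum_comm, ← Finset.sum_add_distrib]
    refine Finset.sum_eq_zero fun k _ => ?_
    rw [← Finset.sum_add_distrib]
    refine Finset.sum_eq_zero fun i _ => ?_
    beta_reduce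
    rw [← TensorProduct.smul_tmul', TensorProduct.tmul_smul, ← add_smul,
      traceForm_lieInvariant, traceForm_comm, neg_add_cancel, zero_smul]

/-- A finite dimensional Lie algebra with nondegenerate Killing form is perfect. -/
theorem LieAlgebra.IsKilling.derivedSeries_one_eq_top (F s : Type*) [Field F] [LieRing s]
    [LieAlgebra F s] [FiniteDimensional F s] [LieAlgebra.IsKilling F s] :
    derivedSeries F s 1 = ⊤ := by
  have h := LieIdeal.isCompl_killingCompl (derivedSeries F s 1)
  have hab : IsLieAbelian (derivedSeries F s 1).killingCompl := by
    refine ⟨fun x y => Subtype.ext ?_⟩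
    have h1 : ⁅(x : s), (y : s)⁆ ∈ derivedSeries F s 1 :=
      LieSubmodule.lie_mem_lie (LieSubmodule.mem_top _) (LieSubmodule.mem_top _)
    have h2 : ⁅(x : s), (y : s)⁆ ∈ (derivedSeries F s 1).killingCompl :=
      LieSubmodule.lie_mem _ y.2
    exact (LieSubmodule.mem_bot _).mp (h.inf_eq_bot ▸ (LieSubmodule.mem_inf _ _ _).mpr ⟨h1, h2⟩)
  have h0 := LieAlgebra.IsKilling.ideal_eq_bot_of_isLieAbelian (derivedSeries F s 1).killingCompl
  have h1 := h.sup_eq_top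
  rwa [h0, sup_bot_eq] at h1

/-- Splitting of a one dimensional trivial quotient with irreducible kernel. -/
theorem LieModule.exists_lie_eq_zero_of_irreducible {s M : Type*} [CharZero F] [LieRing s]
    [LieAlgebra F s] [FiniteDimensional F s] [LieAlgebra.IsKilling F s] [AddCommGroup M]
    [Module F M] [FiniteDimensional F M] [LieRingModule s M] [LieModule F s M] (f : M →ₗ[F] F)
    (hf : ∀ (x : s) (m : M), f ⁅x, m⁆ = 0) (hf0 : f ≠ 0) (N : LieSubmodule F s M)
    (hN : ∀ m, m ∈ N ↔ f m = 0) (hirr : ∀ N' ≤ N, N' = ⊥ ∨ N' = N) :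
    ∃ m, f m = 1 ∧ ∀ x : s, ⁅x, m⁆ = 0 := by
  obtain ⟨m₀, hm₀⟩ : ∃ m, f m = 1 := LinearMap.surjective hf0 1
  by_cases htriv : ∀ (x : s), ∀ n ∈ N, ⁅x, n⁆ = 0
  · refine ⟨m₀, hm₀, fun x => ?_⟩
    have hle : LieAlgebra.derivedSeries F s 1 ≤ LieModule.ker F s M := by
      rw [show LieAlgebra.derivedSeries F s 1 = ⁅(⊤ : LieIdeal F s), (⊤ : LieIdeal F s)⁆ from rfl,
        LieSubmodule.lie_le_iff]
      intro x _ y _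
      rw [LieModule.mem_ker]
      intro m
      rw [lie_lie, htriv x _ ((hN _).mpr (hf y m)), htriv y _ ((hN _).mpr (hf x m)), sub_zero]
    rw [LieAlgebra.IsKilling.derivedSeries_one_eq_top] at hle
    exact (LieModule.mem_ker _ _ _ _).mp (hle (LieSubmodule.mem_top x)) m₀
  let U : LieIdeal F s := LieAlgebra.InvariantForm.orthogonal (traceForm F s N)
    (traceForm_lieInvariant F s N) ⊤
  have hU (x : s) : x ∈ U ↔ ∀ y, traceForm F s N y x = 0 := by
    rw [LieAlgebra.InvariantForm.mem_orthogonal]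
    simp
  have hcompl := LieIdeal.isCompl_killingCompl U
  set j := U.killingCompl
  have hj : ∀ x ∈ j, (∀ y ∈ j, traceForm F s N x y = 0) → x = 0 := by
    intro x hx hxy
    have hxU : x ∈ U := by
      rw [hU]
      intro y
      obtain ⟨u, hu, v, hv, rfl⟩ := (LieSubmodule.mem_sup _ _ y).mp
        (hcompl.sup_eq_top ▸ LieSubmodule.mem_top y)
      rw [map_add, LinearMap.add_apply, traceForm_comm F s N v, hxy v hv, traceForm_comm,
        (hU u).mp hu, add_zero]
    exact (LieSubmodule.mem_bot _).mp
      (hcompl.inf_eq_bot ▸ (LieSubmodule.mem_inf _ _ _).mpr ⟨hxU, hx⟩)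
  have hj0 : Module.finrank F j ≠ 0 := by
    intro h0
    have hjbot : j = ⊥ := by
      rw [← LieSubmodule.toSubmodule_inj]
      exact Submodule.finrank_eq_zero.mp h0
    have hUtop := hcompl.sup_eq_top
    rw [hjbot, sup_bot_eq] at hUtop
    have hB : traceForm F s N = 0 := LinearMap.ext₂ fun y x =>
      (hU x).mp (hUtop ▸ LieSubmodule.mem_top x) y
    have hnil := isNilpotent_derivedSeries_of_traceForm_eq_zero (R := F) (L := s) (M := N) hB
    have hnil' : LieModule.IsNilpotent s N := by
      refine (LieModule.isNilpotent_iff_forall' (R := F)).mpr fun x => ?_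
      have hx : x ∈ LieAlgebra.derivedSeries F s 1 :=
        LieAlgebra.IsKilling.derivedSeries_one_eq_top F s ▸ LieSubmodule.mem_top x
      exact LieModule.isNilpotent_toEnd_of_isNilpotent F (LieAlgebra.derivedSeries F s 1) N ⟨x, hx⟩
    refine htriv fun x n hn => ?_
    have : Nontrivial N := by
      by_contra h
      rw [not_nontrivial_iff_subsingleton] at h
      refine htriv fun x n hn => ?_
      rw [show n = 0 from congrArg Subtype.val (Subsingleton.elim (⟨n, hn⟩ : N) 0), lie_zero]
    have hnt := nontrivial_max_triv_of_isNilpotent F s N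
    rcases hirr ((maxTrivSubmodule F s N).map N.incl) (by
      rw [LieSubmodule.map_le_iff_le_comap]
      exact fun y _ => y.2) with h | h
    · obtain ⟨z, hz⟩ := exists_ne (0 : maxTrivSubmodule F s N)
      have hz' := LieSubmodule.mem_map_of_mem (f := N.incl) z.2
      rw [h, LieSubmodule.mem_bot] at hz'
      exact absurd (Subtype.ext (Subtype.ext hz')) hz
    · rw [← h, LieSubmodule.mem_map] at hn
      obtain ⟨n, hn, rfl⟩ := hn
      exact congrArg Subtype.val (hn x)
  obtain ⟨b, b', hbb, hinv⟩ := j.exists_casimir hj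
  let c : Module.End F M := ∑ i, toEnd F s M (b i) * toEnd F s M (b' i)
  have hc (m : M) : c m = ∑ i, ⁅b i, ⁅b' i, m⁆⁆ := by simp [c]
  have hcomm (x : s) (m : M) : ⁅x, c m⁆ = c ⁅x, m⁆ := by
    let Φ : s ⊗[F] s →ₗ[F] M := TensorProduct.lift (LinearMap.mk₂ F (fun a b => ⁅a, ⁅b, m⁆⁆)
      (by simp) (by simp) (by simp) (by simp))
    have := congrArg Φ (hinv x)
    rw [map_sum, map_zero] at this
    rw [← sub_eq_zero, ← this, hc, hc, lie_sum, ← Finset.sum_sub_distrib]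
    refine Finset.sum_congr rfl fun i _ => ?_
    rw [map_add]
    simp only [Φ, TensorProduct.lift.tmul, LinearMap.mk₂_apply]
    rw [leibniz_lie x (b i), leibniz_lie x (b' i), lie_add]
    abel
  have hcN (m : M) : c m ∈ N := by
    rw [hN, hc, map_sum]
    exact Finset.sum_eq_zero fun i _ => hf _ _
  let cN : Module.End F N := ∑ i, toEnd F s N (b i) * toEnd F s N (b' i)
  have hcNc (n : N) : (cN n : M) = c n := by
    simp [hc, cN]
  have htr : LinearMap.trace F N cN = Module.finrank F j := by
    rw [map_sum]
    refine (Finset.sum_congr rfl fun i _ => hbb i).trans ?_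
    simp
  have hinj : Function.Injective cN := by
    let K : LieSubmodule F s M :=
      { N.toSubmodule ⊓ LinearMap.ker c with
        lie_mem := fun {x m} hm => ⟨N.lie_mem hm.1, by
          change c ⁅x, m⁆ = 0
          rw [← hcomm, show c m = 0 from hm.2, lie_zero]⟩ }
    rw [injective_iff_map_eq_zero]
    intro n hn
    have hnK : (n : M) ∈ K := ⟨n.2, by
      change c n = 0
      rw [← hcNc, hn]
      rfl⟩
    rcases hirr K (fun x hx => hx.1) with h | h
    · rw [h] at hnK
      exact Subtype.ext ((LieSubmodule.mem_bot _).mp hnK)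
    · have hcN0 : cN = 0 := LinearMap.ext fun y => Subtype.ext <| by
        have hy : (y : M) ∈ K := by
          rw [h]
          exact y.2
        rw [hcNc]
        exact hy.2
      rw [hcN0, map_zero] at htr
      exact absurd (Nat.cast_eq_zero.mp htr.symm) hj0
  obtain ⟨n, hn⟩ := LinearMap.surjective_of_injective hinj ⟨c m₀, hcN m₀⟩
  refine ⟨m₀ - n, ?_, fun x => ?_⟩
  · rw [map_sub, hm₀, (hN _).mp n.2, sub_zero]
  · have hmem : ⁅x, m₀ - n⁆ ∈ N := (hN _).mpr (hf _ _)
    have h0 : cN ⟨_, hmem⟩ = 0 := Subtype.ext <| by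
      have hn' : c n = c m₀ := by rw [← hcNc, hn]
      rw [hcNc, ← hcomm, map_sub, hn', sub_self, lie_zero]
      rfl
    exact congrArg Subtype.val (hinj (h0.trans (map_zero cN).symm))

/-- An invariant nonzero functional on a finite dimensional module over a semisimple Lie algebra
takes the value one at some invariant vector. -/
theorem LieModule.exists_lie_eq_zero {s : Type u} [CharZero F] [LieRing s]
    [LieAlgebra F s] [FiniteDimensional F s] [LieAlgebra.IsKilling F s] (k : ℕ) :
    ∀ (M : Type u) [AddCommGroup M] [Module F M] [FiniteDimensional F M] [LieRingModule s M]
      [LieModule F s M], Module.finrank F M = k → ∀ f : M →ₗ[F] F,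
      (∀ (x : s) (m : M), f ⁅x, m⁆ = 0) → f ≠ 0 → ∃ m, f m = 1 ∧ ∀ x : s, ⁅x, m⁆ = 0 := by
  induction k using Nat.strong_induction_on with
  | _ k ih =>
  intro M _ _ _ _ _ hM f hf hf0
  let N : LieSubmodule F s M := { LinearMap.ker f with lie_mem := fun {x m} _ => hf x m }
  have hN (m) : m ∈ N ↔ f m = 0 := Iff.rfl
  by_cases hirr : ∀ N' ≤ N, N' = ⊥ ∨ N' = N
  · exact exists_lie_eq_zero_of_irreducible f hf hf0 N hN hirr
  push Not at hirr
  obtain ⟨N', hle, hbot, hne⟩ := hirr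
  have hfrank : Module.finrank F (M ⧸ N') < k := by
    have h1 := Submodule.finrank_quotient_add_finrank N'.toSubmodule
    have h2 : Module.finrank F N'.toSubmodule ≠ 0 := by
      rw [Ne, Submodule.finrank_eq_zero]
      simpa using hbot
    change Module.finrank F (M ⧸ N'.toSubmodule) < k
    omega
  let f' : M ⧸ N' →ₗ[F] F := N'.toSubmodule.liftQ f hle
  have hf' (m : M) : f' (LieSubmodule.Quotient.mk m) = f m := rfl
  obtain ⟨m', hm'1, hm'⟩ := ih _ hfrank (M ⧸ N') rfl f' (by
      intro x m
      obtain ⟨m, rfl⟩ := LieSubmodule.Quotient.surjective_mk' _ m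
      exact hf x m) (by
      rintro h
      exact hf0 (LinearMap.ext fun m => by rw [← hf', h]; rfl))
  obtain ⟨m, rfl⟩ := LieSubmodule.Quotient.surjective_mk' _ m'
  have hm (x : s) : ⁅x, m⁆ ∈ N' := by
    rw [← LieSubmodule.Quotient.mk_eq_zero, LieModuleHom.map_lie]
    exact hm' x
  have hfm : f m = 1 := hm'1
  let M' : LieSubmodule F s M :=
    { N'.toSubmodule ⊔ Submodule.span F {m} with
      lie_mem := fun {x y} hy => by
        obtain ⟨n, hn, z, hz, rfl⟩ := Submodule.mem_sup.mp hy
        obtain ⟨c, rfl⟩ := Submodule.mem_span_singleton.mp hz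
        rw [lie_add, lie_smul]
        exact Submodule.mem_sup_left (add_mem (N'.lie_mem hn) (Submodule.smul_mem _ _ (hm x))) }
  have hM' : Module.finrank F M' < k := by
    rw [← hM]
    refine Submodule.finrank_lt (s := M'.toSubmodule) ?_
    intro htop
    refine hne (le_antisymm hle fun y hy => ?_)
    obtain ⟨n, hn, z, hz, rfl⟩ := Submodule.mem_sup.mp
      (show y ∈ N'.toSubmodule ⊔ Submodule.span F {m} from
        htop.symm.le Submodule.mem_top)
    obtain ⟨c, rfl⟩ := Submodule.mem_span_singleton.mp hz
    have hy := (hN _).mp hy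
    rw [map_add, (hN n).mp (hle hn), map_smul, hfm, smul_eq_mul, mul_one, zero_add] at hy
    rw [hy, zero_smul, add_zero]
    exact hn
  have hmM' : m ∈ M' := Submodule.mem_sup_right (Submodule.mem_span_singleton_self m)
  obtain ⟨y, hy1, hy⟩ := ih _ hM' M' rfl (f ∘ₗ M'.toSubmodule.subtype) (fun x y => hf x y)
    (fun h => by
      have := LinearMap.congr_fun h ⟨m, hmM'⟩
      exact one_ne_zero (hfm.symm.trans this))
  exact ⟨y, hy1, fun x => congrArg Subtype.val (hy x)⟩

end InvariantVectors

section LeviSplitting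

attribute [local instance] LieRing.ofAssociativeRing

universe u

variable {F : Type u} [Field F]

theorem LieHom.exists_comp_eq_of_ker_le {g s h : Type*} [LieRing g] [LieAlgebra F g] [LieRing s]
    [LieAlgebra F s] [LieRing h] [LieAlgebra F h] {p : g →ₗ⁅F⁆ s} (hp : Function.Surjective p)
    (q : g →ₗ⁅F⁆ h) (hpq : ∀ x, p x = 0 → q x = 0) : ∃ q' : s →ₗ⁅F⁆ h, ∀ x, q' (p x) = q x := by
  obtain ⟨t, ht⟩ := (p : g →ₗ[F] s).exists_rightInverse_of_surjective (LinearMap.range_eq_top.mpr hp)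
  have ht' (x : s) : p (t x) = x := LinearMap.congr_fun ht x
  have key {x y : g} (h : p x = p y) : q x = q y := by
    rw [← sub_eq_zero, ← map_sub]
    exact hpq _ (by rw [map_sub, h, sub_self])
  refine ⟨{ (q : g →ₗ[F] h) ∘ₗ t with map_lie' := fun {x y} => ?_ }, fun x => key (ht' _)⟩
  change q (t ⁅x, y⁆) = ⁅q (t x), q (t y)⁆
  rw [← LieHom.map_lie]
  exact key (by rw [ht', LieHom.map_lie, ht', ht'])

theorem LieHom.exists_section_of_subalgebra {g s : Type*} [LieRing g] [LieAlgebra F g] [LieRing s]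
    [LieAlgebra F s] (p : g →ₗ⁅F⁆ s) (l : LieSubalgebra F g) (hinj : ∀ x ∈ l, p x = 0 → x = 0)
    (hsurj : ∀ y, ∃ x ∈ l, p x = y) : ∃ σ : s →ₗ⁅F⁆ g, ∀ y, p (σ y) = y := by
  let e : l ≃ₗ⁅F⁆ s := LieEquiv.ofBijective (p.comp l.incl) ⟨by
      rw [injective_iff_map_eq_zero]
      exact fun x hx => Subtype.ext (hinj x x.2 hx), fun y => by
      obtain ⟨x, hx, rfl⟩ := hsurj y
      exact ⟨⟨x, hx⟩, rfl⟩⟩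
  exact ⟨l.incl.comp e.symm.toLieHom, fun y => e.apply_symm_apply y⟩

/-- An invariant nonzero functional on a finite dimensional module over an extension of a
semisimple Lie algebra by an ideal acting trivially takes the value one at some invariant
vector. -/
theorem LieModule.exists_lie_eq_zero_of_surjective {g s M : Type u} [CharZero F] [LieRing g]
    [LieAlgebra F g] [LieRing s] [LieAlgebra F s] [FiniteDimensional F s]
    [LieAlgebra.IsKilling F s] {p : g →ₗ⁅F⁆ s} (hp : Function.Surjective p) [AddCommGroup M]
    [Module F M] [FiniteDimensional F M] [LieRingModule g M] [LieModule F g M]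
    (hM : ∀ x, p x = 0 → ∀ m : M, ⁅x, m⁆ = 0) (f : M →ₗ[F] F)
    (hf : ∀ (x : g) (m : M), f ⁅x, m⁆ = 0) (hf0 : f ≠ 0) :
    ∃ m, f m = 1 ∧ ∀ x : g, ⁅x, m⁆ = 0 := by
  obtain ⟨ψ, hψ⟩ := LieHom.exists_comp_eq_of_ker_le hp (toEnd F g M)
    (fun x hx => LinearMap.ext (hM x hx))
  let : LieRingModule s M := LieRingModule.compLieHom M ψ
  have : LieModule F s M := LieModule.compLieHom M ψ
  have hlie (x : g) (m : M) : ⁅p x, m⁆ = ⁅x, m⁆ := LinearMap.congr_fun (hψ x) m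
  obtain ⟨m, hm, hm0⟩ := exists_lie_eq_zero (s := s) _ M rfl f (fun x m => by
    obtain ⟨x, rfl⟩ := hp x
    rw [hlie, hf]) hf0
  exact ⟨m, hm, fun x => by rw [← hlie, hm0]⟩

/-- A projection onto an abelian ideal with semisimple quotient which is equivariant up to inner
derivations. -/
theorem LieHom.exists_projection_of_abelian_ker {g s : Type u} [CharZero F] [LieRing g]
    [LieAlgebra F g] [FiniteDimensional F g] [LieRing s] [LieAlgebra F s] [FiniteDimensional F s]
    [LieAlgebra.IsKilling F s] {p : g →ₗ⁅F⁆ s} (hp : Function.Surjective p)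
    (hab : ∀ x y, p x = 0 → p y = 0 → ⁅x, y⁆ = 0) (hbot : p.ker ≠ ⊥) :
    ∃ φ : g →ₗ[F] g, (∀ x, p (φ x) = 0) ∧ (∀ x, p x = 0 → φ x = x) ∧
      ∀ x : g, ∃ a : g, p a = 0 ∧ ∀ y : g, ⁅x, φ y⁆ - φ ⁅x, y⁆ = ⁅a, y⁆ := by
  let V : LieSubmodule F g (g →ₗ[F] g) :=
    { carrier := {φ | (∀ x, p (φ x) = 0) ∧ ∃ c : F, ∀ x, p x = 0 → φ x = c • x}
      add_mem' := by
        rintro φ ψ ⟨h1, c, h2⟩ ⟨h3, d, h4⟩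
        refine ⟨fun x => by simp [h1, h3], c + d, fun x hx => ?_⟩
        rw [LinearMap.add_apply, h2 x hx, h4 x hx, add_smul]
      zero_mem' := ⟨by simp, 0, by simp⟩
      smul_mem' := by
        rintro a φ ⟨h1, c, h2⟩
        refine ⟨fun x => by simp [h1], a * c, fun x hx => ?_⟩
        rw [LinearMap.smul_apply, h2 x hx, mul_smul]
      lie_mem := by
        rintro x φ ⟨h1, c, h2⟩
        refine ⟨fun y => by simp [h1, LieHom.lie_apply], 0, fun y hy => ?_⟩
        rw [LieHom.lie_apply, h2 y hy, h2 ⁅x, y⁆ (by simp [hy]), lie_smul, sub_self, zero_smul] }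
  have hV (φ : g →ₗ[F] g) : φ ∈ V ↔ (∀ x, p (φ x) = 0) ∧ ∃ c : F, ∀ x, p x = 0 → φ x = c • x :=
    Iff.rfl
  have had (x a : g) : ⁅x, (LieAlgebra.ad F g a : g →ₗ[F] g)⁆ = LieAlgebra.ad F g ⁅x, a⁆ := by
    ext y
    rw [LieHom.lie_apply]
    simp
  let P : LieSubmodule F g V :=
    { carrier := {φ | ∃ a, p a = 0 ∧ (φ : g →ₗ[F] g) = LieAlgebra.ad F g a}
      add_mem' := by
        rintro φ ψ ⟨a, ha, h1⟩ ⟨b, hb, h2⟩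
        exact ⟨a + b, by simp [ha, hb], by rw [LieSubmodule.coe_add, h1, h2, map_add]⟩
      zero_mem' := ⟨0, by simp, by simp⟩
      smul_mem' := by
        rintro c φ ⟨a, ha, h1⟩
        exact ⟨c • a, by simp [ha], by rw [LieSubmodule.coe_smul, h1, map_smul]⟩
      lie_mem := by
        rintro x φ ⟨a, ha, h1⟩
        exact ⟨⁅x, a⁆, by simp [ha], by rw [LieSubmodule.coe_bracket, h1, had]⟩ }
  have hP (φ : V) : φ ∈ P ↔ ∃ a, p a = 0 ∧ (φ : g →ₗ[F] g) = LieAlgebra.ad F g a := Iff.rfl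
  obtain ⟨r, hr, hr0⟩ : ∃ r, p r = 0 ∧ r ≠ 0 := by
    by_contra! h
    exact hbot (le_bot_iff.mp fun x hx => (LieSubmodule.mem_bot _).mpr (h x (p.mem_ker.mp hx)))
  obtain ⟨δ, hδ⟩ := Module.Projective.exists_dual_eq_one F hr0
  let f : V →ₗ[F] F := δ ∘ₗ LinearMap.applyₗ r ∘ₗ V.toSubmodule.subtype
  have hf (φ : V) : f φ = δ ((φ : g →ₗ[F] g) r) := rfl
  have hPf : P.toSubmodule ≤ LinearMap.ker f := by
    rintro φ ⟨a, ha, h⟩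
    rw [LinearMap.mem_ker, hf, h, LieAlgebra.ad_apply, hab a r ha hr, map_zero]
  let f' : V ⧸ P →ₗ[F] F := P.toSubmodule.liftQ f hPf
  have hf' (φ : V) : f' (LieSubmodule.Quotient.mk' P φ) = f φ := rfl
  obtain ⟨m, hm1, hm⟩ := LieModule.exists_lie_eq_zero_of_surjective hp (M := V ⧸ P) (by
      intro x hx m
      obtain ⟨⟨φ, h1, c, h2⟩, rfl⟩ := LieSubmodule.Quotient.surjective_mk' _ m
      rw [← LieModuleHom.map_lie, LieSubmodule.Quotient.mk_eq_zero, hP]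
      refine ⟨-(c • x), by simp [hx], LinearMap.ext fun y => ?_⟩
      change ⁅x, φ y⁆ - φ ⁅x, y⁆ = ⁅-(c • x), y⁆
      rw [hab _ _ hx (h1 y), h2 _ (by simp [hx]), zero_sub, neg_lie, smul_lie]) f' (by
      intro x m
      obtain ⟨⟨φ, h1, c, h2⟩, rfl⟩ := LieSubmodule.Quotient.surjective_mk' _ m
      rw [← LieModuleHom.map_lie, hf', hf]
      change δ (⁅x, φ r⁆ - φ ⁅x, r⁆) = 0
      rw [h2 r hr, h2 ⁅x, r⁆ (by simp [hr]), lie_smul, sub_self, map_zero]) (by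
      intro h0
      obtain ⟨π, hπ⟩ := p.ker.toSubmodule.subtype.exists_leftInverse_of_injective
        (Submodule.ker_subtype _)
      have hπV : p.ker.toSubmodule.subtype ∘ₗ π ∈ V := by
        refine ⟨fun x => p.mem_ker.mp (π x).2, 1, fun x hx => ?_⟩
        rw [one_smul]
        exact congrArg Subtype.val (LinearMap.congr_fun hπ ⟨x, p.mem_ker.mpr hx⟩)
      have h1 : f ⟨_, hπV⟩ = 1 := by
        rw [hf, ← hδ]
        exact congrArg δ (congrArg Subtype.val (LinearMap.congr_fun hπ ⟨r, p.mem_ker.mpr hr⟩))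
      rw [← hf', h0] at h1
      exact zero_ne_one h1)
  obtain ⟨⟨φ, h1, c, h2⟩, rfl⟩ := LieSubmodule.Quotient.surjective_mk' _ m
  have hc : c = 1 := by
    rw [hf', hf] at hm1
    change δ (φ r) = 1 at hm1
    rwa [h2 r hr, map_smul, hδ, smul_eq_mul, mul_one] at hm1
  refine ⟨φ, h1, fun x hx => by rw [h2 x hx, hc, one_smul], fun x => ?_⟩
  have hx := hm x
  rw [← LieModuleHom.map_lie, LieSubmodule.Quotient.mk_eq_zero, hP] at hx
  obtain ⟨a, ha, h⟩ := hx
  exact ⟨a, ha, fun y => LinearMap.congr_fun h y⟩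

/-- Levi splitting when the kernel is an abelian minimal ideal. -/
theorem LieHom.exists_section_of_minimal_ker {g s : Type u} [CharZero F] [LieRing g]
    [LieAlgebra F g] [FiniteDimensional F g] [LieRing s] [LieAlgebra F s] [FiniteDimensional F s]
    [LieAlgebra.IsKilling F s] {p : g →ₗ⁅F⁆ s} (hp : Function.Surjective p)
    (hsol : LieAlgebra.IsSolvable p.ker) (hmin : ∀ r' ≤ p.ker, r' = ⊥ ∨ r' = p.ker) :
    ∃ σ : s →ₗ⁅F⁆ g, ∀ y, p (σ y) = y := by
  by_cases hbot : p.ker = ⊥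
  · refine p.exists_section_of_subalgebra ⊤ (fun x _ hx => ?_) (fun y => ?_)
    · rwa [← p.mem_ker, hbot, LieSubmodule.mem_bot] at hx
    · obtain ⟨x, rfl⟩ := hp y
      exact ⟨x, trivial, rfl⟩
  have hab : ∀ x y, p x = 0 → p y = 0 → ⁅x, y⁆ = 0 := by
    rcases hmin ⁅p.ker, p.ker⁆ (LieSubmodule.lie_le_right _ _) with h | h
    · intro x y hx hy
      rw [← LieSubmodule.mem_bot (R := F) (L := g), ← h]
      exact LieSubmodule.lie_mem_lie (p.mem_ker.mpr hx) (p.mem_ker.mpr hy)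
    · obtain ⟨k, hk⟩ := p.ker.isSolvable_iff_exists.mp hsol
      refine absurd ?_ hbot
      rw [← hk]
      clear hk
      induction k with
      | zero => rfl
      | succ k ih => rw [LieAlgebra.derivedSeriesOfIdeal_succ, ← ih, h]
  obtain ⟨φ, h1, h2, h3⟩ := exists_projection_of_abelian_ker hp hab hbot
  rcases hmin (LieAlgebra.center F g ⊓ p.ker) inf_le_right with h | h
  · let l : LieSubalgebra F g :=
      { carrier := {x | ∀ y : g, ⁅x, φ y⁆ = φ ⁅x, y⁆}
        add_mem' := fun {x y} hx hy z => by simp only [add_lie, map_add, hx z, hy z]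
        zero_mem' := fun z => by simp
        smul_mem' := fun c x hx z => by simp only [smul_lie, map_smul, hx z]
        lie_mem' := fun {x y} hx hy z => by
          simp only [lie_lie, map_sub, hx _, hy _] }
    refine p.exists_section_of_subalgebra l (fun x hx hpx => ?_) (fun y => ?_)
    · rw [← LieSubmodule.mem_bot (R := F) (L := g), ← h]
      refine (LieSubmodule.mem_inf _ _ _).mpr ⟨fun y => ?_, p.mem_ker.mpr hpx⟩
      rw [← lie_skew, ← h2 ⁅x, y⁆ (by simp [hpx]), ← hx y, hab _ _ hpx (h1 y), neg_zero]
    · obtain ⟨x, rfl⟩ := hp y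
      obtain ⟨a, ha, h4⟩ := h3 x
      refine ⟨x + a, fun z => ?_, by simp [ha]⟩
      rw [add_lie, add_lie, map_add, hab a _ ha (h1 z), add_zero, h2 ⁅a, z⁆ (by simp [ha]), ← h4]
      abel
  · have hcen (x : g) (hx : p x = 0) (y : g) : ⁅y, x⁆ = 0 := by
      have hx' := p.mem_ker.mpr hx
      rw [← h] at hx'
      exact ((LieSubmodule.mem_inf _ _ _).mp hx').1 y
    let l : LieSubalgebra F g :=
      { LinearMap.ker φ with
        lie_mem' := fun {x y} hx hy => by
          obtain ⟨a, ha, h4⟩ := h3 x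
          have h5 := h4 y
          rw [show φ y = 0 from hy, lie_zero, ← lie_skew a y, hcen a ha, zero_sub, neg_zero,
            neg_eq_zero] at h5
          exact h5 }
    refine p.exists_section_of_subalgebra l (fun x hx hpx => ?_) (fun y => ?_)
    · exact (h2 x hpx).symm.trans hx
    · obtain ⟨x, rfl⟩ := hp y
      refine ⟨x - φ x, ?_, by simp [h1]⟩
      change φ (x - φ x) = 0
      rw [map_sub, h2 _ (h1 x), sub_self]

/-- **Levi's theorem**: an extension of a semisimple Lie algebra by a solvable ideal splits. -/
theorem LieHom.exists_section_of_isSolvable_ker {s : Type u} [CharZero F] [LieRing s]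
    [LieAlgebra F s] [FiniteDimensional F s] [LieAlgebra.IsKilling F s] (k : ℕ) :
    ∀ (g : Type u) [LieRing g] [LieAlgebra F g] [FiniteDimensional F g],
      Module.finrank F g = k → ∀ p : g →ₗ⁅F⁆ s, Function.Surjective p →
      LieAlgebra.IsSolvable p.ker → ∃ σ : s →ₗ⁅F⁆ g, ∀ y, p (σ y) = y := by
  induction k using Nat.strong_induction_on with
  | _ k ih =>
  intro g _ _ _ hg p hp hsol
  by_cases hmin : ∀ r' ≤ p.ker, r' = ⊥ ∨ r' = p.ker
  · exact exists_section_of_minimal_ker hp hsol hmin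
  push Not at hmin
  obtain ⟨r, hle, hbot, hne⟩ := hmin
  obtain ⟨q, hq⟩ := exists_comp_eq_of_ker_le r.quotientHom_surjective p
    (fun x hx => p.mem_ker.mp (hle (r.quotientHom_eq_zero_iff.mp hx)))
  have hqsurj : Function.Surjective q := fun y => by
    obtain ⟨x, rfl⟩ := hp y
    exact ⟨_, hq x⟩
  have hqsol : LieAlgebra.IsSolvable q.ker := by
    let e : p.ker →ₗ⁅F⁆ q.ker :=
      { toFun := fun x => ⟨r.quotientHom x, q.mem_ker.mpr (by rw [hq]; exact p.mem_ker.mp x.2)⟩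
        map_add' := fun x y => Subtype.ext (map_add r.quotientHom (x : g) y)
        map_smul' := fun c x => Subtype.ext (map_smul r.quotientHom c (x : g))
        map_lie' := fun {x y} => Subtype.ext (LieHom.map_lie r.quotientHom (x : g) y) }
    refine Function.Surjective.lieAlgebra_isSolvable (f := e) ?_
    rintro ⟨y, hy⟩
    obtain ⟨x, rfl⟩ := r.quotientHom_surjective y
    exact ⟨⟨x, p.mem_ker.mpr (by rw [← hq]; exact q.mem_ker.mp hy)⟩, rfl⟩
  have hfrank : Module.finrank F (g ⧸ r) < k := by
    have h1 := Submodule.finrank_quotient_add_finrank r.toSubmodule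
    have h2 : Module.finrank F r.toSubmodule ≠ 0 := by
      rw [Ne, Submodule.finrank_eq_zero]
      simpa using hbot
    change Module.finrank F (g ⧸ r.toSubmodule) < k
    omega
  obtain ⟨τ, hτ⟩ := ih _ hfrank (g ⧸ r) rfl q hqsurj hqsol
  let g' : LieSubalgebra F g := τ.range.comap r.quotientHom
  have hg' (x : g) : x ∈ g' ↔ ∃ y, τ y = r.quotientHom x := Iff.rfl
  have hker (x : g) (hx : x ∈ g') (hpx : p x = 0) : x ∈ r := by
    obtain ⟨y, hy⟩ := (hg' x).mp hx
    have h1 := hτ y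
    rw [hy, hq, hpx] at h1
    rwa [← h1, map_zero, eq_comm, r.quotientHom_eq_zero_iff] at hy
  have hfrank' : Module.finrank F g' < k := by
    rw [← hg]
    refine Submodule.finrank_lt (s := g'.toSubmodule) fun htop => hne (le_antisymm hle ?_)
    intro x hx
    exact hker x (htop.symm.le Submodule.mem_top) (p.mem_ker.mp hx)
  have hsol' : LieAlgebra.IsSolvable (p.comp g'.incl).ker := by
    let e : (p.comp g'.incl).ker →ₗ⁅F⁆ p.ker :=
      { toFun := fun x => ⟨(x : g'), p.mem_ker.mpr ((p.comp g'.incl).mem_ker.mp x.2)⟩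
        map_add' := fun x y => rfl
        map_smul' := fun c x => rfl
        map_lie' := fun {x y} => rfl }
    refine Function.Injective.lieAlgebra_isSolvable (f := e) ?_
    intro x y h
    exact Subtype.ext (Subtype.ext (congrArg (fun z : p.ker => (z : g)) h))
  obtain ⟨σ, hσ⟩ := ih _ hfrank' g' rfl (p.comp g'.incl) (fun y => by
    obtain ⟨x, hx⟩ := r.quotientHom_surjective (τ y)
    refine ⟨⟨x, (hg' x).mpr ⟨y, hx.symm⟩⟩, ?_⟩
    change p x = y
    rw [← hq, hx, hτ]) hsol'
  exact ⟨g'.incl.comp σ, hσ⟩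

end LeviSplitting

section Ado

attribute [local instance] LieRing.ofAssociativeRing

universe u

/-- **Ado's theorem** in characteristic zero. -/
theorem LieAlgebra.exists_injective_end (F g : Type u) [Field F] [CharZero F] [LieRing g]
    [LieAlgebra F g] [FiniteDimensional F g] :
    ∃ (V : Type u) (_ : AddCommGroup V) (_ : Module F V) (_ : FiniteDimensional F V)
      (φ : g →ₗ⁅F⁆ Module.End F V), Function.Injective φ := by
  let r := radical F g
  have : HasTrivialRadical F (g ⧸ r) := hasTrivialRadical_quotient_radical F g
  have hker : r.quotientHom.ker = r := by
    ext x
    rw [LieHom.mem_ker, r.quotientHom_eq_zero_iff]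
  obtain ⟨σ, hσ⟩ := LieHom.exists_section_of_isSolvable_ker (s := g ⧸ r) _ g rfl r.quotientHom
    r.quotientHom_surjective (by
      rw [hker]
      infer_instance)
  let P : g →ₗ[F] r :=
    LinearMap.codRestrict r.toSubmodule
      (LinearMap.id - (σ : g ⧸ r →ₗ[F] g) ∘ₗ (r.quotientHom : g →ₗ[F] g ⧸ r)) fun x => by
      refine r.quotientHom_eq_zero_iff.mp ?_
      change r.quotientHom (x - σ (r.quotientHom x)) = 0
      rw [map_sub, hσ, sub_self]
  have hP (x : g) : (P x : g) = x - σ (r.quotientHom x) := rfl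
  let n : LieIdeal F g := ⁅(⊤ : LieIdeal F g), r⁆
  have hn (x : g) (y : g) (hy : y ∈ r) : ⁅x, y⁆ ∈ n :=
    LieSubmodule.lie_mem_lie (LieSubmodule.mem_top x) hy
  obtain ⟨V, _, _, _, ρ, hρ, hρn⟩ := exists_faithful_of_isNilpotent_ad _ r rfl (n.comap r.incl)
    (fun x y => hn x y y.2)
    (fun y hy => r.isNilpotent_ad_of_coe (r.isNilpotent_toEnd_of_isSolvable hy))
  obtain ⟨W, _, _, _, τ, hτ, -⟩ := r.exists_extension n hn P
    (fun y => Subtype.ext (by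
      rw [hP, r.quotientHom_eq_zero_iff.mpr y.2, map_zero, sub_zero]))
    (fun x y => Subtype.ext (by
      change ⁅x, y⁆ - σ (r.quotientHom ⁅x, y⁆) = ⁅x, y - σ (r.quotientHom y)⁆ -
        ⁅y, x - σ (r.quotientHom x)⁆ - ⁅x - σ (r.quotientHom x), y - σ (r.quotientHom y)⁆
      simp only [LieHom.map_lie, lie_sub, sub_lie]
      rw [← lie_skew y x, ← lie_skew (σ (r.quotientHom x)) y]
      abel))
    ρ hρ (fun y hy => hρn y hy)
  refine ⟨W × g, inferInstance, inferInstance, inferInstance, τ.prodEnd (ad F g), ?_⟩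
  rw [injective_iff_map_eq_zero]
  intro x hx
  obtain ⟨h1, h2⟩ := LieHom.prodEnd_eq_zero_iff.mp hx
  refine hτ x (center_le_radical F g ?_) h1
  intro y
  rw [← lie_skew, ← ad_apply (R := F), h2, LinearMap.zero_apply, neg_zero]

end Ado

section Grading

attribute [local instance] LieRing.ofAssociativeRing

/-- The ranges of the inclusions of the coefficients grade a monoid algebra. -/
theorem MonoidAlgebra.isInternal_range_lsingle (F E T : Type*) [Field F] [Ring E] [Module F E]
    [DecidableEq T] :
    DirectSum.IsInternal
      fun t : T => LinearMap.range (MonoidAlgebra.lsingle t : E →ₗ[F] MonoidAlgebra E T) := by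
  rw [DirectSum.isInternal_submodule_iff_iSupIndep_and_iSup_eq_top]
  constructor
  · intro t
    rw [Submodule.disjoint_def]
    rintro _ ⟨a, rfl⟩ hx
    have key : ∀ x ∈ ⨆ (s : T) (_ : s ≠ t),
        LinearMap.range (MonoidAlgebra.lsingle s : E →ₗ[F] MonoidAlgebra E T), x.coeff t = 0 := by
      have : (⨆ (s : T) (_ : s ≠ t),
          LinearMap.range (MonoidAlgebra.lsingle s : E →ₗ[F] MonoidAlgebra E T)) ≤
          LinearMap.ker (Finsupp.lapply t ∘ₗ
            (MonoidAlgebra.coeffLinearEquiv F : MonoidAlgebra E T ≃ₗ[F] T →₀ E).toLinearMap) := by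
        refine iSup₂_le fun s hs => ?_
        rintro _ ⟨b, rfl⟩
        simp [MonoidAlgebra.lsingle, hs]
      exact fun x hx => this hx
    have h := key _ hx
    have : a = 0 := by simpa [MonoidAlgebra.lsingle] using h
    rw [this, map_zero]
  · rw [eq_top_iff]
    intro x _
    rw [← MonoidAlgebra.sum_coeff_single x]
    exact Submodule.sum_mem _ fun t _ => Submodule.mem_iSup_of_mem t ⟨x.coeff t, rfl⟩

/-- A homomorphism from a Lie algebra graded by a commutative semigroup to an associative algebra
lifts to a graded homomorphism to the semigroup algebra. -/
theorem LieAlgebra.exists_graded_lift {F E T L : Type*} [Field F] [Ring E] [Algebra F E]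
    [CommSemigroup T] [DecidableEq T] [LieRing L] [LieAlgebra F L] {Lg : T → Submodule F L}
    (hinternal : DirectSum.IsInternal Lg)
    (hgraded : ∀ s t : T, ∀ x ∈ Lg s, ∀ y ∈ Lg t, ⁅x, y⁆ ∈ Lg (s * t)) (φ : L →ₗ⁅F⁆ E) :
    ∃ ρ : L →ₗ[F] MonoidAlgebra E T,
      (∀ t, ∀ x ∈ Lg t, ρ x = MonoidAlgebra.single t (φ x)) ∧
      (∀ x y, ρ ⁅x, y⁆ = ρ x * ρ y - ρ y * ρ x) ∧
      ∀ x, ρ x = 0 → φ x = 0 := by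
  let e := LinearEquiv.ofBijective (DirectSum.coeLinearMap Lg) hinternal
  let ρ : L →ₗ[F] MonoidAlgebra E T :=
    DirectSum.toModule F T _ (fun t =>
      (MonoidAlgebra.lsingle t : E →ₗ[F] MonoidAlgebra E T) ∘ₗ (φ : L →ₗ[F] E) ∘ₗ
        (Lg t).subtype) ∘ₗ e.symm.toLinearMap
  have hρ : ∀ t, ∀ x ∈ Lg t, ρ x = MonoidAlgebra.single t (φ x) := by
    intro t x hx
    have h : e.symm x = DirectSum.lof F T (fun t => Lg t) t ⟨x, hx⟩ := by
      rw [LinearEquiv.symm_apply_eq]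
      exact (DirectSum.coeLinearMap_lof Lg t ⟨x, hx⟩).symm
    change DirectSum.toModule F T _ _ (e.symm x) = _
    rw [h, DirectSum.toModule_lof]
    rfl
  have htop (x : L) : x ∈ ⨆ t, Lg t := hinternal.submodule_iSup_eq_top ▸ Submodule.mem_top
  refine ⟨ρ, hρ, fun x y => ?_, ?_⟩
  · induction htop x using Submodule.iSup_induction' with
    | zero => simp
    | add x x' _ _ hx hx' =>
      rw [add_lie, map_add, hx, hx', map_add, add_mul, mul_add]
      abel
    | mem s x hx =>
      induction htop y using Submodule.iSup_induction' with
      | zero => simp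
      | add y y' _ _ hy hy' =>
        rw [lie_add, map_add, hy, hy', map_add, add_mul, mul_add]
        abel
      | mem t y hy =>
        rw [hρ _ _ (hgraded s t x hx y hy), hρ s x hx, hρ t y hy, LieHom.map_lie,
          LieRing.of_associative_ring_bracket, MonoidAlgebra.single_mul_single,
          MonoidAlgebra.single_mul_single, mul_comm t s, MonoidAlgebra.single_sub]
  · let ε : MonoidAlgebra E T →ₗ[F] E :=
      Finsupp.lsum F (fun _ => LinearMap.id) ∘ₗ (MonoidAlgebra.coeffLinearEquiv F).toLinearMap
    have hε : ∀ x, ε (ρ x) = φ x := by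
      intro x
      induction htop x using Submodule.iSup_induction' with
      | zero => simp
      | add x x' _ _ hx hx' => rw [map_add, map_add, hx, hx', map_add]
      | mem t x hx =>
        rw [hρ t x hx]
        simp [ε]
    intro x hx
    rw [← hε, hx, map_zero]

end Grading

/-- **Graded Ado theorem** (Theorem 2.2): every finite dimensional Lie algebra over a field of
characteristic zero graded by a finite commutative semigroup `T` admits a faithful
finite dimensional graded representation in a `T`-graded associative algebra. -/
theorem statement0 (F : Type) [Field F] [CharZero F]
    (T : Type) [CommSemigroup T] [DecidableEq T] [Finite T]
    (L : Type) [LieRing L] [LieAlgebra F L] [Module.Finite F L]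
    (Lg : T → Submodule F L)
    (hinternal : DirectSum.IsInternal Lg)
    (hgraded : ∀ s t : T, ∀ x ∈ Lg s, ∀ y ∈ Lg t, ⁅x, y⁆ ∈ Lg (s * t)) :
    Nonempty (GradedAdoWitness F T L Lg) := by
  obtain ⟨V, _, _, _, φ, hφ⟩ := LieAlgebra.exists_injective_end F L
  obtain ⟨ρ, hρ, hbr, hker⟩ := LieAlgebra.exists_graded_lift hinternal hgraded φ
  exact ⟨{
    A := MonoidAlgebra (Module.End F V) T
    findim := Module.Finite.equiv
      (MonoidAlgebra.coeffLinearEquiv F : MonoidAlgebra (Module.End F V) T ≃ₗ[F] _).symm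
    Ag := fun t => LinearMap.range
      (MonoidAlgebra.lsingle t : Module.End F V →ₗ[F] MonoidAlgebra (Module.End F V) T)
    internal := MonoidAlgebra.isInternal_range_lsingle F (Module.End F V) T
    gradedMul := by
      rintro s t _ ⟨a, rfl⟩ _ ⟨b, rfl⟩
      exact ⟨a * b, (MonoidAlgebra.single_mul_single s t a b).symm⟩
    ρ := ρ
    inj := (injective_iff_map_eq_zero ρ).mpr fun x hx =>
      (injective_iff_map_eq_zero φ).mp hφ x (hker x hx)
    bracket := hbr
    mapsInto := by
      rintro t _ ⟨x, hx, rfl⟩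
      exact ⟨φ x, (hρ t x hx).symm⟩ }⟩
end

section
/- Let q ≥ 4 be an integer. Let Ω_q = { x ∈ ℝ^q : x₁ + ⋯ + x_q = 1, x₁ ≥ x₂ ≥ ⋯ ≥ x_q ≥ 0, and x_{q−1} + x_q ≤ x₁ }, and let Φ(x₁, …, x_q) = ∏_{i=1}^q x_i^{−x_i} (real-number exponentiation, with the convention 0⁰ = 1). Then (q − 3) + 2√2 is the greatest value of Φ on Ω_q; that is, Φ(x) ≤ (q − 3) + 2√2 for all x ∈ Ω_q, and this value is attained at some point of Ω_q. -/
open Finset in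
/-- The Gibbs inequality in multiplicative form. -/
theorem prod_rpow_neg_self_mul_prod_rpow_le {ι : Type*} [Fintype ι] (x w : ι → ℝ)
    (hx : ∀ i, 0 ≤ x i) (hsum : ∑ i, x i = 1) (hw : ∀ i, 0 < w i) :
    (∏ i, x i ^ (-(x i))) * ∏ i, w i ^ x i ≤ ∑ i, w i := by
  have h := Real.geom_mean_le_arith_mean_weighted univ x (fun i => w i / x i)
    (fun i _ => hx i) hsum (fun i _ => div_nonneg (hw i).le (hx i))
  calc (∏ i, x i ^ (-(x i))) * ∏ i, w i ^ x i = ∏ i, (w i / x i) ^ x i := by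
        rw [← prod_mul_distrib]
        refine prod_congr rfl fun i _ => ?_
        rw [Real.div_rpow (hw i).le (hx i), Real.rpow_neg (hx i), div_eq_mul_inv, mul_comm]
    _ ≤ ∑ i, x i * (w i / x i) := h
    _ ≤ ∑ i, w i := by
        refine sum_le_sum fun i _ => ?_
        rcases (hx i).eq_or_lt with h0 | h0
        · simp [← h0, (hw i).le]
        · rw [mul_div_cancel₀ _ h0.ne']

open Finset in
/-- Equality in the Gibbs inequality for the normalized weights. -/
theorem prod_rpow_neg_self_mul_prod_rpow_eq {ι : Type*} [Fintype ι] (x w : ι → ℝ) {Z : ℝ}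
    (hZ : 0 < Z) (hx : ∀ i, x i = w i / Z) (hsum : ∑ i, x i = 1) (hw : ∀ i, 0 < w i) :
    (∏ i, x i ^ (-(x i))) * ∏ i, w i ^ x i = Z := by
  have hpos : ∀ i, 0 < x i := fun i => hx i ▸ div_pos (hw i) hZ
  calc (∏ i, x i ^ (-(x i))) * ∏ i, w i ^ x i = ∏ i, Z ^ x i := by
        rw [← prod_mul_distrib]
        refine prod_congr rfl fun i _ => ?_
        have hZx : Z = w i / x i := by
          rw [eq_div_iff (hpos i).ne', hx i, mul_div_cancel₀ _ hZ.ne']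
        rw [hZx, Real.div_rpow (hw i).le (hpos i).le, Real.rpow_neg (hpos i).le,
          div_eq_mul_inv, mul_comm]
    _ = Z := by rw [← Real.rpow_sum_of_pos hZ, hsum, Real.rpow_one]

/-- The exponent `1` at `a`, `-1` at `b` and `c`, and `0` elsewhere. -/
def balanceExponent {ι : Type*} [DecidableEq ι] (a b c i : ι) : ℝ :=
  (if i = a then 1 else 0) - (if i = b then 1 else 0) - (if i = c then 1 else 0)

/-- The weight maximizing entropy under the constraint `x b + x c ≤ x a`. -/
noncomputable def balanceWeight {ι : Type*} [DecidableEq ι] (a b c i : ι) : ℝ :=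
  √2 ^ balanceExponent a b c i

theorem balanceWeight_pos {ι : Type*} [DecidableEq ι] (a b c i : ι) :
    0 < balanceWeight a b c i := by
  unfold balanceWeight
  positivity

theorem prod_balanceWeight_rpow {ι : Type*} [Fintype ι] [DecidableEq ι] (a b c : ι)
    (x : ι → ℝ) : ∏ i, balanceWeight a b c i ^ x i = √2 ^ (x a - x b - x c) := by
  have h2 : (0 : ℝ) < √2 := by positivity
  simp only [balanceWeight, ← Real.rpow_mul h2.le]
  rw [← Real.rpow_sum_of_pos h2]
  simp [balanceExponent, sub_mul, Finset.sum_sub_distrib]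

theorem inv_sqrt_two : (√2 : ℝ)⁻¹ = √2 / 2 := by
  rw [inv_eq_one_div, div_eq_div_iff (by positivity) two_ne_zero]
  simp

theorem balanceWeight_eq {ι : Type*} [DecidableEq ι] {a b c : ι} (hab : a ≠ b) (hac : a ≠ c)
    (hbc : b ≠ c) (i : ι) :
    balanceWeight a b c i = if i = a then √2 else if i = b ∨ i = c then √2 / 2 else 1 := by
  rw [← inv_sqrt_two]
  unfold balanceWeight balanceExponent
  by_cases ha : i = a
  · subst ha; simp [hab, hac]
  by_cases hb : i = b
  · subst hb; simp [hab.symm, hbc, Real.rpow_neg_one]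
  by_cases hc : i = c
  · subst hc; simp [hac.symm, hbc.symm, Real.rpow_neg_one]
  simp [ha, hb, hc]

theorem sum_balanceWeight {ι : Type*} [Fintype ι] [DecidableEq ι] {a b c : ι} (hab : a ≠ b)
    (hac : a ≠ c) (hbc : b ≠ c) :
    ∑ i, balanceWeight a b c i = (Fintype.card ι : ℝ) - 3 + 2 * √2 := by
  have h : ∀ i, balanceWeight a b c i = 1 + (if i = a then √2 - 1 else 0)
      + (if i = b then √2 / 2 - 1 else 0) + (if i = c then √2 / 2 - 1 else 0) := by
    intro i
    rw [balanceWeight_eq hab hac hbc]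
    split_ifs <;> grind
  simp only [h, Finset.sum_add_distrib, Finset.sum_ite_eq', Finset.mem_univ, if_true,
    Finset.sum_const, Finset.card_univ, nsmul_eq_mul]
  ring


/-- **Lemma 2.6**: for `q ≥ 4`, the greatest value of
`Φ(x) = ∏ᵢ xᵢ^(−xᵢ)` on the region
`Ω_q = {x ∈ ℝ^q : ∑ xᵢ = 1, x₁ ≥ … ≥ x_q ≥ 0, x_{q−1} + x_q ≤ x₁}`
is `(q − 3) + 2√2`. -/
theorem statement1 (q : ℕ) (hq : 4 ≤ q) :
    IsGreatest
      ((fun x : Fin q → ℝ => ∏ i, x i ^ (-(x i))) ''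
        {x : Fin q → ℝ | (∑ i, x i) = 1 ∧ (∀ i j : Fin q, i ≤ j → x j ≤ x i) ∧
          (∀ i, 0 ≤ x i) ∧
          x ⟨q - 2, by omega⟩ + x ⟨q - 1, by omega⟩ ≤ x ⟨0, by omega⟩})
      ((q : ℝ) - 3 + 2 * Real.sqrt 2) := by
  set a : Fin q := ⟨0, by omega⟩ with ha
  set b : Fin q := ⟨q - 2, by omega⟩ with hb
  set c : Fin q := ⟨q - 1, by omega⟩ with hc
  have hab : a ≠ b := by simp only [ha, hb, ne_eq, Fin.mk.injEq]; omega
  have hac : a ≠ c := by simp only [ha, hc, ne_eq, Fin.mk.injEq]; omega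
  have hbc : b ≠ c := by simp only [hb, hc, ne_eq, Fin.mk.injEq]; omega
  have hsum := sum_balanceWeight hab hac hbc
  rw [Fintype.card_fin] at hsum
  have h1 : 1 ≤ √2 := Real.one_le_sqrt.2 one_le_two
  have h2 : √2 ≤ 2 := Real.sqrt_le_iff.2 (by norm_num)
  set Z : ℝ := (q : ℝ) - 3 + 2 * √2
  have hZ : 0 < Z := by
    have : (4 : ℝ) ≤ q := by exact_mod_cast hq
    linarith
  constructor
  · have hx1 : ∑ i, balanceWeight a b c i / Z = 1 := by
      rw [← Finset.sum_div, hsum, div_self hZ.ne']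
    have hw := balanceWeight_eq hab hac hbc
    have hbal : balanceWeight a b c b + balanceWeight a b c c = balanceWeight a b c a := by
      simp [hw, hab.symm, hac.symm]
    refine ⟨fun i => balanceWeight a b c i / Z, ⟨hx1, fun i j hij => ?_, fun i =>
      div_nonneg (balanceWeight_pos a b c i).le hZ.le, ?_⟩, ?_⟩
    · refine div_le_div_of_nonneg_right ?_ hZ.le
      have key : (j = a → i = a) ∧ (i = b ∨ i = c → j = b ∨ j = c) := by
        simp only [ha, hb, hc, Fin.ext_iff, Fin.le_def] at hij ⊢
        omega
      rw [hw, hw]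
      split_ifs <;> first | linarith | grind
    · rw [← add_div, hbal]
    · have h := prod_rpow_neg_self_mul_prod_rpow_eq (fun i => balanceWeight a b c i / Z)
        (balanceWeight a b c) hZ (fun _ => rfl) hx1 (balanceWeight_pos a b c)
      rw [prod_balanceWeight_rpow] at h
      have h0 : balanceWeight a b c a / Z - balanceWeight a b c b / Z
          - balanceWeight a b c c / Z = 0 := by
        rw [← hbal]; ring
      simpa only [h0, Real.rpow_zero, mul_one] using h
  · rintro _ ⟨x, ⟨hx1, -, hx0, hxc⟩, rfl⟩
    have h := prod_rpow_neg_self_mul_prod_rpow_le x (balanceWeight a b c) hx0 hx1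
      (balanceWeight_pos a b c)
    rw [prod_balanceWeight_rpow, hsum] at h
    have hone : 1 ≤ √2 ^ (x a - x b - x c) := Real.one_le_rpow h1 (by linarith)
    exact (le_mul_of_one_le_right
      (Finset.prod_nonneg fun i _ => Real.rpow_nonneg (hx0 i) _) hone).trans h
end

section
/- There exists a point α = (α₁, α₂, α₃, α₄, α₅) ∈ ℝ⁵ with α₁ + α₂ + α₃ + α₄ + α₅ = 1, α₁ ≥ α₂ ≥ α₃ ≥ α₄ ≥ α₅ > 0, and α₄ + α₅ ≤ α₁, such that ∏_{i=1}^5 α_i^{−α_i} = 2 + 2√2. -/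
/-- There is a point `α ∈ ℝ⁵` with `∑ αᵢ = 1`, `α₁ ≥ α₂ ≥ α₃ ≥ α₄ ≥ α₅ > 0` and
`α₄ + α₅ ≤ α₁` at which `∏ᵢ αᵢ^(−αᵢ) = 2 + 2√2`. -/
theorem statement2 :
    ∃ α : Fin 5 → ℝ,
      (∑ i, α i) = 1 ∧
      (∀ i j : Fin 5, i ≤ j → α j ≤ α i) ∧
      0 < α 4 ∧
      α 3 + α 4 ≤ α 0 ∧
      (∏ i, α i ^ (-(α i))) = 2 + 2 * Real.sqrt 2 := by
  obtain ⟨s, hs⟩ : ∃ s, s = Real.sqrt 2 := ⟨_, rfl⟩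
  have hsq : s * s = 2 := by rw [hs]; exact Real.mul_self_sqrt (by norm_num)
  have hs0 : 0 < s := by rw [hs]; positivity
  have hs1 : 1.4 < s := by nlinarith
  have hs2 : s < 1.42 := by nlinarith
  obtain ⟨b, hb⟩ : ∃ b, b = (s - 1) / 2 := ⟨_, rfl⟩
  have hb0 : 0 < b := by rw [hb]; linarith
  have hbinv : b⁻¹ = 2 + 2 * s := by
    apply inv_eq_of_mul_eq_one_right
    rw [hb]
    linarith
  have hlog₁ : Real.log (s * b) = Real.log s + Real.log b :=
    Real.log_mul hs0.ne' hb0.ne'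
  have hlog₂ : Real.log (b / s) = Real.log b - Real.log s :=
    Real.log_div hb0.ne' hs0.ne'
  have hdiv : b / s = s * b / 2 := by
    rw [div_eq_div_iff hs0.ne' two_ne_zero]
    linear_combination -b * hsq
  have hsb : s * b = (2 - s) / 2 := by rw [hb]; linarith
  have hsum : 2 * (s * b) + 2 * b = 1 := by rw [hsb, hb]; ring
  have hle₁ : b ≤ s * b := by linarith
  have hle₂ : b / s ≤ b := by linarith
  rw [← hs]
  refine ⟨![s * b, b, b, b / s, b / s], ?_, ?_, ?_, ?_, ?_⟩
  · simp only [Fin.sum_univ_five, Matrix.cons_val]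
    rw [hdiv]
    linarith
  · have hanti : Antitone ![s * b, b, b, b / s, b / s] := by
      rw [Fin.antitone_iff_succ_le]
      intro i
      fin_cases i <;> simp [Fin.succ, hle₁, hle₂]
    exact fun i j hij => hanti hij
  · exact div_pos hb0 hs0
  · change b / s + b / s ≤ s * b
    rw [hdiv]
    linarith
  · simp only [Fin.prod_univ_five, Matrix.cons_val]
    rw [Real.rpow_def_of_pos (mul_pos hs0 hb0), Real.rpow_def_of_pos hb0,
      Real.rpow_def_of_pos (div_pos hb0 hs0), ← Real.exp_add, ← Real.exp_add, ← Real.exp_add,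
      ← Real.exp_add, ← hbinv, ← Real.exp_log (inv_pos.2 hb0), Real.log_inv, hlog₁, hlog₂, hdiv]
    congr 1
    linear_combination -Real.log b * hsum
end
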